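/- arXiv:math/0504195 — 3 statements merged into one kernel-verified Lean document; each statement's English description precedes it below -/
import Mathlib

section
/- For every n ≥ 1, the sequence I_{n,0}, I_{n,1}, ..., I_{n,n-1} is unimodal; more precisely, I_{n,k} ≥ I_{n,k-1} for all 1 ≤ k ≤ (n-1)/2 and I_{n,k} ≥ I_{n,k+1} for all (n-1)/2 ≤ k ≤ n-2. -/
open Finset Polynomial

/-- Number of descents of a permutation of `Fin n`. -/
def desNum {n : ℕ} (π : Equiv.Perm (Fin n)) : ℕ :=
  (Finset.univ.filter fun i : Fin n =>
    ∃ j : Fin n, (j : ℕ) = (i : ℕ) + 1 ∧ π j < π i).card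

/-- `invCount n k` is the number of involutions of `{1,…,n}` with exactly `k` descents. -/
def invCount (n k : ℕ) : ℕ :=
  (Finset.univ.filter fun π : Equiv.Perm (Fin n) => π * π = 1 ∧ desNum π = k).card

/-- `fpfInvCount n k` is the number of fixed-point-free involutions of `{1,…,n}`
with exactly `k` descents. -/
def fpfInvCount (n k : ℕ) : ℕ :=
  (Finset.univ.filter fun π : Equiv.Perm (Fin n) =>
    π * π = 1 ∧ (∀ i, π i ≠ i) ∧ desNum π = k).card


/-- symmetric matrices with natural entries and total sum `n` -/
def symMat (n m : ℕ) : Finset (Fin m × Fin m → ℕ) :=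
  (Finset.piAntidiag (Finset.univ : Finset (Fin m × Fin m)) n).filter
    fun A => ∀ x, A x.swap = A x

theorem mem_symMat {n m : ℕ} {A : Fin m × Fin m → ℕ} :
    A ∈ symMat n m ↔ (∑ x, A x = n) ∧ ∀ x, A x.swap = A x := by
  simp [symMat, Finset.mem_piAntidiag]

theorem symMat_step {m : ℕ} (n w : ℕ) (x : Fin m × Fin m) (E : Fin m × Fin m → ℕ)
    (hw : ∑ y, E y = w) (hx : E x = 1) (hs : ∀ y, E y.swap = E y)
    (hE : ∀ A : Fin m × Fin m → ℕ, (∀ y, A y.swap = A y) → A x ≠ 0 → ∀ y, E y ≤ A y) :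
    ∑ A ∈ symMat (n + w) m, A x = ∑ A ∈ symMat n m, (A x + 1) := by
  symm
  refine Finset.sum_bij_ne_zero (fun A _ _ => A + E) ?_ ?_ ?_ ?_
  · intro A hA _
    rw [mem_symMat] at hA ⊢
    refine ⟨by simp [Finset.sum_add_distrib, hA.1, hw], fun y => by simp [hA.2, hs]⟩
  · intro A _ _ B _ _ h
    exact add_right_cancel h
  · intro A hA h0
    rw [mem_symMat] at hA
    have hle := hE A hA.2 h0
    have hadd : (A - E) + E = A := by
      funext y; simp [Nat.sub_add_cancel (hle y)]
    refine ⟨A - E, ?_, by simp, hadd⟩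
    rw [mem_symMat]
    refine ⟨?_, fun y => by simp [hA.2, hs]⟩
    have := hA.1
    rw [← hadd] at this
    simp only [Pi.add_apply, Finset.sum_add_distrib, hw] at this
    exact Nat.add_right_cancel this
  · intro A _ _
    simp [hx]

theorem symMat_diag {m : ℕ} (n : ℕ) (a : Fin m) :
    ∑ A ∈ symMat (n + 1) m, A (a, a) = ∑ A ∈ symMat n m, A (a, a) + (symMat n m).card := by
  rw [symMat_step n 1 (a, a) (fun y => if y = (a, a) then 1 else 0)]
  · simp [Finset.sum_add_distrib]
  · simp
  · simp
  · rintro ⟨b, c⟩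
    simp [and_comm]
  · intro A _ h y
    split_ifs with hy
    · subst hy; omega
    · omega

theorem symMat_off {m : ℕ} (n : ℕ) (a b : Fin m) (hab : a ≠ b) :
    ∑ A ∈ symMat (n + 2) m, A (a, b) = ∑ A ∈ symMat n m, A (a, b) + (symMat n m).card := by
  rw [symMat_step n 2 (a, b)
    (fun y => (if y = (a, b) then 1 else 0) + (if y = (b, a) then 1 else 0))]
  · simp [Finset.sum_add_distrib]
  · simp [Finset.sum_add_distrib]
  · simp [hab]
  · rintro ⟨c, d⟩
    simp only [Prod.swap_prod_mk, Prod.mk.injEq]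
    rw [add_comm]
    simp [and_comm]
  · intro A hs h y
    have h2 := hs (a, b)
    simp only [Prod.swap_prod_mk] at h2
    by_cases h3 : y = (a, b)
    · subst h3; simp [hab]; omega
    · by_cases h4 : y = (b, a)
      · subst h4; simp [hab.symm]; omega
      · simp [h3, h4]

theorem symMat_total (n m : ℕ) :
    n * (symMat n m).card = ∑ a : Fin m, ∑ b : Fin m, ∑ A ∈ symMat n m, A (a, b) := by
  rw [← Fintype.sum_prod_type' (f := fun a b => ∑ A ∈ symMat n m, A (a, b)), Finset.sum_comm]
  rw [Finset.sum_congr rfl (g := fun _ => n)]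
  · simp [mul_comm]
  · intro A hA
    exact (mem_symMat.1 hA).1

theorem symMat_rec (n m : ℕ) :
    (n + 2) * (symMat (n + 2) m).card
      = m * (symMat (n + 1) m).card + (m ^ 2 + n) * (symMat n m).card := by
  have key : ∀ a b : Fin m, ∑ A ∈ symMat (n + 2) m, A (a, b)
      = ∑ A ∈ symMat n m, A (a, b) + (symMat n m).card
        + if a = b then (symMat (n + 1) m).card else 0 := by
    intro a b
    split_ifs with h
    · subst h
      rw [symMat_diag, symMat_diag]
    · rw [symMat_off n a b h, add_zero]
  rw [symMat_total]
  simp only [key, Finset.sum_add_distrib, ← symMat_total]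
  simp
  ring

/-- the basis polynomials -/
def bb (n k r : ℕ) : ℤ := if k ≤ r then ((n + (r - k)).choose n : ℤ) else 0

theorem bb_pascal (n k r : ℕ) : bb n k r = bb (n + 1) k r - bb (n + 1) (k + 1) r := by
  unfold bb
  by_cases h : k ≤ r
  · obtain ⟨j, rfl⟩ := Nat.exists_eq_add_of_le h
    rcases j with _ | j
    · simp
    · have h1 : k + (j + 1) - (k + 1) = j := by omega
      have h2 : k + (j + 1) - k = j + 1 := by omega
      have h3 : k + 1 ≤ k + (j + 1) := by omega
      rw [if_pos h, if_pos h, if_pos h3, h1, h2]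
      have := Nat.choose_succ_succ (n + (j + 1)) n
      rw [show n + 1 + (j + 1) = (n + (j + 1)).succ by omega, show n + 1 + j = n + (j+1) by omega]
      rw [this]; push_cast; ring
  · have : ¬ (k + 1 ≤ r) := by omega
    simp [h, this]

theorem bb_mul (n k r : ℕ) :
    ((r : ℤ) + 1) * bb n k r
      = ((k : ℤ) + 1) * bb (n + 1) k r + ((n : ℤ) - k) * bb (n + 1) (k + 1) r := by
  unfold bb
  by_cases h : k ≤ r
  · obtain ⟨j, rfl⟩ := Nat.exists_eq_add_of_le h
    rcases j with _ | j
    · simp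
    · have h1 : k + (j + 1) - (k + 1) = j := by omega
      have h2 : k + (j + 1) - k = j + 1 := by omega
      have h3 : k + 1 ≤ k + (j + 1) := by omega
      rw [if_pos h, if_pos h, if_pos h3, h1, h2]
      have := Nat.choose_succ_succ (n + (j + 1)) n
      rw [show n + 1 + (j + 1) = (n + (j + 1)).succ by omega, show n + 1 + j = n + (j+1) by omega]
      rw [this]
      have h5 := Nat.choose_succ_right_eq (n + (j + 1)) n
      rw [show n + (j + 1) - n = j + 1 by omega] at h5
      have h6 : (((n + (j+1)).choose (n+1) : ℕ) : ℤ) * (n + 1) = ((n + (j+1)).choose n : ℕ) * (j + 1) := by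
        exact_mod_cast h5
      push_cast
      rw [Nat.succ_eq_add_one]
      linear_combination -h6
  · have : ¬ (k + 1 ≤ r) := by omega
    simp [h, this]

theorem bb_shift (f : ℤ → ℤ) (hf : f (-1) = 0) (n r : ℕ) :
    ∑ k ∈ range (r + 1), f k * bb n (k + 1) r = ∑ k ∈ range (r + 1), f ((k : ℤ) - 1) * bb n k r := by
  rw [Finset.sum_range_succ, Finset.sum_range_succ']
  simp [hf, bb]

theorem bb_unique (n : ℕ) (f g : ℤ → ℤ)
    (h : ∀ r : ℕ, ∑ k ∈ range (r + 1), f k * bb n k r = ∑ k ∈ range (r + 1), g k * bb n k r) :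
    ∀ k : ℕ, f k = g k := by
  intro k
  induction k using Nat.strong_induction_on with
  | _ k ih =>
    have := h k
    rw [Finset.sum_range_succ, Finset.sum_range_succ] at this
    rw [Finset.sum_congr rfl (g := fun j : ℕ => g j * bb n j k)] at this
    · simpa [bb] using this
    · intro j hj
      rw [ih j (by simpa using hj)]

theorem rec_of_counts (n : ℕ) (f0 f1 f2 : ℤ → ℤ) (h0 : ∀ k < 0, f0 k = 0) (h1 : ∀ k < 0, f1 k = 0)
    (h2 : ∀ k < 0, f2 k = 0)
    (c0 : ∀ r : ℕ, ∑ k ∈ range (r + 1), f0 k * bb n k r = (symMat n (r + 1)).card)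
    (c1 : ∀ r : ℕ, ∑ k ∈ range (r + 1), f1 k * bb (n + 1) k r = (symMat (n + 1) (r + 1)).card)
    (c2 : ∀ r : ℕ, ∑ k ∈ range (r + 1), f2 k * bb (n + 2) k r = (symMat (n + 2) (r + 1)).card)
    (k : ℤ) :
    ((n : ℤ) + 2) * f2 k = (k + 1) * f1 k + (n + 2 - k) * f1 (k - 1)
      + ((k + 1) ^ 2 + n) * f0 k + (2 * k * (n + 1 - k) - n + 1) * f0 (k - 1)
      + ((n + 2 - k) ^ 2 + n) * f0 (k - 2) := by
  rcases lt_or_ge k 0 with hk | hk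
  · rw [h2 k hk, h1 k hk, h1 (k-1) (by omega), h0 k hk, h0 (k-1) (by omega), h0 (k-2) (by omega)]
    ring
  lift k to ℕ using hk
  refine bb_unique (n + 2) (fun k => ((n : ℤ) + 2) * f2 k) (fun k => (k + 1) * f1 k + (n + 2 - k) * f1 (k - 1)
      + ((k + 1) ^ 2 + n) * f0 k + (2 * k * (n + 1 - k) - n + 1) * f0 (k - 1)
      + ((n + 2 - k) ^ 2 + n) * f0 (k - 2)) ?_ k
  intro r
  have e1 : ∑ k ∈ range (r + 1), ((n : ℤ) + 1 - k) * f1 k * bb (n + 2) (k + 1) r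
      = ∑ k ∈ range (r + 1), ((n : ℤ) + 2 - k) * f1 (k - 1) * bb (n + 2) k r := by
    rw [bb_shift (fun k => (n + 1 - k) * f1 k) (by simp [h1]) (n + 2) r]
    refine Finset.sum_congr rfl fun j _ => ?_
    ring
  have e2 : ∑ k ∈ range (r + 1), (2 * ((k : ℤ) + 1) * (n - k) - n + 1) * f0 k * bb (n + 2) (k + 1) r
      = ∑ k ∈ range (r + 1), (2 * k * ((n : ℤ) + 1 - k) - n + 1) * f0 (k - 1) * bb (n + 2) k r := by
    rw [bb_shift (fun k => (2 * (k + 1) * (n - k) - n + 1) * f0 k) (by simp [h0]) (n + 2) r]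
    refine Finset.sum_congr rfl fun j _ => ?_
    ring
  have e3 : ∑ k ∈ range (r + 1), (((n : ℤ) + 1 - k) ^ 2 + n) * f0 (k - 1) * bb (n + 2) (k + 1) r
      = ∑ k ∈ range (r + 1), (((n : ℤ) + 2 - k) ^ 2 + n) * f0 (k - 2) * bb (n + 2) k r := by
    rw [bb_shift (fun k => ((n + 1 - k) ^ 2 + n) * f0 (k - 1)) (by simp [h0]) (n + 2) r]
    refine Finset.sum_congr rfl fun j _ => ?_
    rw [show (j : ℤ) - 1 - 1 = j - 2 by ring]
    ring
  have e4 : ∑ k ∈ range (r + 1), (((n : ℤ) - k) ^ 2 + n) * f0 k * bb (n + 2) (k + 2) r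
      = ∑ k ∈ range (r + 1), (((n : ℤ) + 1 - k) ^ 2 + n) * f0 (k - 1) * bb (n + 2) (k + 1) r := by
    rw [Finset.sum_range_succ, Finset.sum_range_succ']
    have z1 : bb (n + 2) (r + 2) r = 0 := by simp [bb]
    have z2 : f0 (((0 : ℕ) : ℤ) - 1) = 0 := h0 _ (by simp)
    rw [z1, z2, mul_zero, mul_zero, zero_mul]
    congr 1
    refine Finset.sum_congr rfl fun j _ => ?_
    rw [show (((j + 1 : ℕ) : ℤ)) - 1 = j by push_cast; ring]
    push_cast
    ring
  have hrec : ((n : ℤ) + 2) * (symMat (n + 2) (r + 1)).card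
      = (r + 1) * (symMat (n + 1) (r + 1)).card + ((r + 1) ^ 2 + n) * (symMat n (r + 1)).card := by
    exact_mod_cast symMat_rec n (r + 1)
  rw [← c0, ← c1, ← c2] at hrec
  calc ∑ k ∈ range (r + 1), ((n : ℤ) + 2) * f2 k * bb (n + 2) k r
      = ((n : ℤ) + 2) * ∑ k ∈ range (r + 1), f2 k * bb (n + 2) k r := by
        rw [Finset.mul_sum]
        exact Finset.sum_congr rfl fun j _ => by ring
    _ = _ := hrec
    _ = ∑ k ∈ range (r + 1), ((k + 1) * f1 k * bb (n + 2) k r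
          + ((n : ℤ) + 1 - k) * f1 k * bb (n + 2) (k + 1) r
          + ((k + 1) ^ 2 + n) * f0 k * bb (n + 2) k r
          + (2 * ((k : ℤ) + 1) * (n - k) - n + 1) * f0 k * bb (n + 2) (k + 1) r
          + (((n : ℤ) - k) ^ 2 + n) * f0 k * bb (n + 2) (k + 2) r) := by
        rw [Finset.mul_sum, Finset.mul_sum, ← Finset.sum_add_distrib]
        refine Finset.sum_congr rfl fun j _ => ?_
        have a1 := bb_mul (n + 1) j r
        have a2 := bb_mul n j r
        have a3 := bb_mul (n + 1) (j + 1) r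
        have b1 := bb_pascal n j r
        have b2 := bb_pascal (n + 1) j r
        have b3 := bb_pascal (n + 1) (j + 1) r
        push_cast at a1 a2 a3
        linear_combination (f1 j) * a1 + f0 j * ((r + 1) * a2 + (j + 1) * a1 + (n - j) * a3)
          + f0 j * n * (b1 + b2 - b3)
    _ = _ := by
        simp only [Finset.sum_add_distrib]
        rw [e1, e2, e4, e3]
        simp only [← Finset.sum_add_distrib]
        exact Finset.sum_congr rfl fun j _ => by ring

theorem mono_unique {α : Type*} [LinearOrder α] {n : ℕ} (f g : Fin n → α)
    (hf : Monotone f) (hg : Monotone g)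
    (h : ∀ x, (univ.filter fun i => f i = x).card = (univ.filter fun i => g i = x).card) :
    f = g := by
  have e : ∀ x, {i // g i = x} ≃ {i // f i = x} := fun x =>
    Fintype.equivOfCardEq (by
      rw [Fintype.card_subtype, Fintype.card_subtype]; exact (h x).symm)
  let σ : Equiv.Perm (Fin n) :=
    (Equiv.sigmaFiberEquiv g).symm.trans ((Equiv.sigmaCongrRight e).trans (Equiv.sigmaFiberEquiv f))
  have hσ : f ∘ σ = g := by
    funext i
    exact (e (g i) ⟨i, rfl⟩).2
  have := Tuple.unique_monotone (f := f) (σ := σ) (τ := Equiv.refl _) (by rw [hσ]; exact hg)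
    (by simpa using hf)
  rw [hσ] at this
  rw [this]; rfl

theorem card_filter_perm {n : ℕ} (σ : Equiv.Perm (Fin n)) (p : Fin n → Prop) [DecidablePred p] :
    (univ.filter fun i => p (σ i)).card = (univ.filter fun i => p i).card := by
  refine Finset.card_equiv σ ?_
  simp

theorem mono_exists {α : Type*} [LinearOrder α] [Fintype α] {n : ℕ} (A : α → ℕ)
    (hA : ∑ x, A x = n) :
    ∃ f : Fin n → α, Monotone f ∧ ∀ x, (univ.filter fun i => f i = x).card = A x := by
  have e : Fin n ≃ (Σ x, Fin (A x)) := Fintype.equivOfCardEq (by simp [hA])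
  let f0 : Fin n → α := fun i => (e i).1
  refine ⟨f0 ∘ Tuple.sort f0, Tuple.monotone_sort f0, fun x => ?_⟩
  have h1 := card_filter_perm (Tuple.sort f0) (fun i => f0 i = x)
  refine h1.trans ?_
  rw [← Fintype.card_subtype]
  have e2 : {i // f0 i = x} ≃ {p : (Σ x, Fin (A x)) // p.1 = x} :=
    e.subtypeEquiv (fun i => Iff.rfl)
  rw [Fintype.card_congr e2, Fintype.card_congr (Equiv.sigmaSubtype x)]
  simp

/-- A permutation together with a compatible weakly increasing sequence. -/
def Compat {n m : ℕ} (π : Equiv.Perm (Fin n)) (s : Fin n → Fin m) : Prop :=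
  Monotone s ∧ ∀ i j, i < j → s i = s j → π i < π j

theorem compat_lex {n m : ℕ} {π : Equiv.Perm (Fin n)} {s : Fin n → Fin m} (h : Compat π s) :
    Monotone (fun i => toLex (s i, s (π i))) := by
  intro i j hij
  rcases hij.eq_or_lt with rfl | hlt
  · exact le_rfl
  rw [Prod.Lex.toLex_le_toLex]
  rcases (h.1 hij).eq_or_lt with h1 | h1
  · exact Or.inr ⟨h1, h.1 (h.2 i j hlt h1).le⟩
  · exact Or.inl h1

theorem compat_sort {n m : ℕ} {π : Equiv.Perm (Fin n)} {s : Fin n → Fin m} (hπ : π * π = 1)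
    (h : Compat π s) : π = Tuple.sort (s ∘ π) := by
  have hh : ∀ i, π (π i) = i := fun i => by
    rw [← Equiv.Perm.mul_apply, hπ]; rfl
  rw [Tuple.eq_sort_iff]
  constructor
  · intro i j hij
    simpa [hh] using h.1 hij
  · intro i j hij he
    exact h.2 i j hij (by simpa [hh] using he)

theorem compat_exists {n m : ℕ} (A : Fin m × Fin m → ℕ) (hA : ∑ x, A x = n)
    (hs : ∀ x, A x.swap = A x) :
    ∃ (π : Equiv.Perm (Fin n)) (s : Fin n → Fin m), π * π = 1 ∧ Compat π s ∧
      ∀ x, (univ.filter fun i => (s i, s (π i)) = x).card = A x := by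
  obtain ⟨p, hp, hc⟩ := mono_exists (α := Fin m ×ₗ Fin m) (n := n) (fun x => A (ofLex x))
    (by rw [← hA]; exact Fintype.sum_equiv ofLex _ _ (fun _ => rfl))
  let a : Fin n → Fin m := fun i => (ofLex (p i)).1
  let b : Fin n → Fin m := fun i => (ofLex (p i)).2
  have hpab : p = fun i => toLex (a i, b i) := rfl
  have hcount : ∀ x y, (univ.filter fun i => a i = x ∧ b i = y).card = A (x, y) := by
    intro x y
    refine Eq.trans ?_ (hc (toLex (x, y)))
    congr 1
    ext i
    simp [hpab]
  have ha : Monotone a := by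
    intro i j hij
    have := hp hij
    rw [hpab] at this
    simp only [Prod.Lex.toLex_le_toLex] at this
    rcases this with h | h
    · exact h.le
    · exact h.1.le
  let σ := Tuple.sort b
  obtain ⟨s1, s2⟩ := Tuple.eq_sort_iff.1 (rfl : σ = Tuple.sort b)
  -- the swapped sequence is the same
  have hq : (fun i => toLex (b (σ i), a (σ i))) = p := by
    apply mono_unique _ _ _ hp
    · intro x
      obtain ⟨⟨x, y⟩, rfl⟩ := toLex.surjective x
      rw [hc]
      simp only [ofLex_toLex]
      rw [← hs, Prod.swap_prod_mk, ← hcount, ← card_filter_perm σ (fun i => a i = y ∧ b i = x)]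
      congr 1
      ext i
      simp [and_comm]
    · intro i j hij
      rcases hij.eq_or_lt with rfl | hlt
      · exact le_rfl
      rw [Prod.Lex.toLex_le_toLex]
      rcases (s1 hij).eq_or_lt with h1 | h1
      · exact Or.inr ⟨h1, ha (s2 i j hlt h1).le⟩
      · exact Or.inl h1
  have hb : ∀ i, b (σ i) = a i := fun i => by
    have := congrFun hq i
    rw [hpab] at this
    simpa using congrArg (fun z => (ofLex z).1) this
  have haσ : ∀ i, a (σ i) = b i := fun i => by
    have := congrFun hq i
    rw [hpab] at this
    simpa using congrArg (fun z => (ofLex z).2) this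
  have hcomp : ∀ i j, i < j → a i = a j → σ i < σ j := fun i j hij h =>
    s2 i j hij (by rw [hb, hb, h])
  have hinv : σ⁻¹ = σ := by
    show σ⁻¹ = Tuple.sort b
    rw [Tuple.eq_sort_iff]
    have hb' : ∀ i, b (σ⁻¹ i) = a i := fun i => by rw [← haσ]; simp
    constructor
    · intro i j hij
      show b (σ⁻¹ i) ≤ b (σ⁻¹ j)
      rw [hb', hb']
      exact ha hij
    · intro i j hij he
      rw [hb', hb'] at he
      by_contra hlt
      rw [not_lt] at hlt
      have hne : σ⁻¹ j ≠ σ⁻¹ i := fun h => hij.ne (σ⁻¹.injective h).symm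
      have hlt' := lt_of_le_of_ne hlt hne
      rcases (ha hlt).eq_or_lt with h1 | h1
      · have := hcomp _ _ hlt' h1
        simp at this
        exact absurd this (not_lt.2 hij.le)
      · have h3 := ha (hcomp i j hij he).le
        rw [haσ, haσ] at h3
        have h4 := hb (σ⁻¹ i)
        have h5 := hb (σ⁻¹ j)
        simp at h4 h5
        rw [h4, h5] at h3
        exact absurd h1 (not_lt.2 h3)
  refine ⟨σ, a, ?_, ⟨ha, hcomp⟩, ?_⟩
  · nth_rewrite 1 [← hinv]; simp
  · rintro ⟨x, y⟩
    rw [← hcount]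
    congr 1
    ext i
    simp [haσ]

open Classical in
theorem card_compat (n m : ℕ) :
    ∑ π ∈ (univ.filter fun π : Equiv.Perm (Fin n) => π * π = 1),
      (univ.filter fun s : Fin n → Fin m => Compat π s).card = (symMat n m).card := by
  rw [← Finset.card_sigma]
  refine Finset.card_bij
    (fun q _ => fun x => (univ.filter fun i => (q.2 i, q.2 (q.1 i)) = x).card) ?_ ?_ ?_
  · rintro ⟨π, s⟩ hq
    simp only [Finset.mem_sigma, Finset.mem_filter, Finset.mem_univ, true_and] at hq
    have hh : ∀ i, π (π i) = i := fun i => by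
      rw [← Equiv.Perm.mul_apply, hq.1]; rfl
    rw [mem_symMat]
    constructor
    · have := Finset.card_eq_sum_card_fiberwise (s := (univ : Finset (Fin n)))
        (t := (univ : Finset (Fin m × Fin m))) (f := fun i => (s i, s (π i))) (by simp)
      rw [← this]; simp
    · rintro ⟨x, y⟩
      simp only [Prod.swap_prod_mk]
      rw [← card_filter_perm π]
      congr 1
      ext i
      simp [hh, and_comm]
  · rintro ⟨π, s⟩ hq ⟨π', s'⟩ hq' h
    simp only [Finset.mem_sigma, Finset.mem_filter, Finset.mem_univ, true_and] at hq hq'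
    have hp := mono_unique _ _ (compat_lex hq.2) (compat_lex hq'.2) (by
      intro x
      have := congrFun h (ofLex x)
      exact this)
    have h1 : s = s' := by
      funext i
      simpa using congrArg (fun z => (ofLex z).1) (congrFun hp i)
    have h2 : s ∘ π = s' ∘ π' := by
      funext i
      simpa using congrArg (fun z => (ofLex z).2) (congrFun hp i)
    have h3 : π = π' := by
      rw [compat_sort hq.1 hq.2, compat_sort hq'.1 hq'.2, h2]
    subst h1 h3
    rfl
  · intro A hA
    rw [mem_symMat] at hA
    obtain ⟨π, s, h1, h2, h3⟩ := compat_exists A hA.1 hA.2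
    refine ⟨⟨π, s⟩, ?_, ?_⟩
    · simp [h1, h2]
    · funext x
      exact h3 x

theorem card_adj (N r : ℕ) (P : Fin N → Prop) [DecidablePred P] :
    (univ.filter fun s : Fin (N + 1) → Fin (r + 1) =>
      ∀ i : Fin N, (s i.castSucc : ℕ) + (if P i then 1 else 0) ≤ s i.succ).card
      = (N + 1 + r - (univ.filter P).card).choose (N + 1) := by
  set k := (univ.filter P).card with hk
  let d : Fin (N + 1) → ℕ := fun i => (univ.filter fun j : Fin N => j.castSucc < i ∧ P j).card
  have d0 : d 0 = 0 := by simp [d]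
  have dsucc : ∀ i : Fin N, d i.succ = d i.castSucc + if P i then 1 else 0 := by
    intro i
    have : (univ.filter fun j : Fin N => j.castSucc < i.succ ∧ P j)
        = (univ.filter fun j : Fin N => j.castSucc < i.castSucc ∧ P j)
          ∪ (if P i then {i} else ∅) := by
      ext j
      simp only [Finset.mem_filter, Finset.mem_univ, true_and, Finset.mem_union, Fin.lt_def,
        Fin.val_castSucc, Fin.val_succ]
      by_cases hij : j = i
      · subst hij
        by_cases hp : P j <;> simp [hp]
      · have : (j : ℕ) ≠ i := fun h => hij (Fin.ext h)
        have h2 : (j : ℕ) < i + 1 ↔ (j : ℕ) < i := by omega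
        rw [h2]
        by_cases hp : P i <;> simp [hp, hij]
    simp only [d]
    rw [this, Finset.card_union_of_disjoint]
    · split_ifs <;> simp
    · split_ifs <;> simp
  have dle : ∀ i, d i ≤ i := by
    intro i
    induction i using Fin.induction with
    | zero => simp [d0]
    | succ i ih =>
      rw [dsucc]
      simp only [Fin.val_castSucc, Fin.val_succ] at *
      split_ifs <;> omega
  have dk : ∀ i, d i ≤ k := fun i =>
    Finset.card_le_card (fun j hj => by simp at hj ⊢; exact hj.2)
  have dlast : d (Fin.last N) = k := by
    simp [d, hk, Fin.castSucc_lt_last]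
  let t : (Fin (N + 1) → Fin (r + 1)) → Fin (N + 1) → ℕ := fun s i => s i + i - d i
  have tmono : ∀ s : Fin (N + 1) → Fin (r + 1),
      (∀ i : Fin N, (s i.castSucc : ℕ) + (if P i then 1 else 0) ≤ s i.succ) →
      StrictMono (t s) := by
    intro s hs
    rw [Fin.strictMono_iff_lt_succ]
    intro i
    have h1 := hs i
    have h2 := dsucc i
    have h3 := dle i.castSucc
    have h4 := dle i.succ
    simp only [t]
    simp only [Fin.val_castSucc, Fin.val_succ] at *
    omega
  rw [← Finset.card_range (N + 1 + r - k), ← Finset.card_powersetCard]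
  refine Finset.card_bij (fun s _ => univ.image (t s)) ?_ ?_ ?_
  · intro s hs
    simp only [Finset.mem_filter, Finset.mem_univ, true_and] at hs
    rw [Finset.mem_powersetCard]
    refine ⟨?_, ?_⟩
    · intro x hx
      simp only [Finset.mem_image, Finset.mem_univ, true_and] at hx
      obtain ⟨i, rfl⟩ := hx
      have h1 := (tmono s hs).monotone (Fin.le_last i)
      have h2 := (s (Fin.last N)).2
      have h3 := dle (Fin.last N)
      rw [Finset.mem_range]
      simp only [t, dlast, Fin.val_last] at *
      omega
    · rw [Finset.card_image_of_injective _ (tmono s hs).injective]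
      simp
  · intro s hs s' hs' h
    simp only [Finset.mem_filter, Finset.mem_univ, true_and] at hs hs'
    have hc : (univ.image (t s)).card = N + 1 := by
      rw [Finset.card_image_of_injective _ (tmono s hs).injective]
      simp
    have e1 := Finset.orderEmbOfFin_unique hc (f := t s) (by intro x; simp) (tmono s hs)
    have e2 := Finset.orderEmbOfFin_unique hc (f := t s') (by intro x; rw [h]; simp)
      (tmono s' hs')
    have e3 := e1.trans e2.symm
    funext i
    have e4 := congrFun e3 i
    have e5 := dle i
    simp only [t] at e4
    apply Fin.ext
    omega
  · intro S hS
    rw [Finset.mem_powersetCard] at hS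
    obtain ⟨hS1, hS2⟩ := hS
    let e := S.orderEmbOfFin hS2
    have emono : StrictMono e := e.strictMono
    have estep : ∀ i : Fin N, e i.castSucc < e i.succ := fun i => emono (Fin.castSucc_lt_succ)
    have elow : ∀ i : Fin (N + 1), (i : ℕ) ≤ e i := by
      intro i
      induction i using Fin.induction with
      | zero => simp
      | succ i ih =>
        have := estep i
        simp only [Fin.val_castSucc, Fin.val_succ] at *
        omega
    have ehigh : ∀ i : Fin (N + 1), e i + k ≤ r + i := by
      intro i
      induction i using Fin.reverseInduction with
      | last =>
        have := hS1 (Finset.orderEmbOfFin_mem S hS2 (Fin.last N))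
        rw [Finset.mem_range] at this
        change e (Fin.last N) < _ at this
        simp only [Fin.val_last]
        omega
      | cast i ih =>
        have := estep i
        simp only [Fin.val_castSucc, Fin.val_succ] at *
        omega
    let s : Fin (N + 1) → Fin (r + 1) := fun i => ⟨e i + d i - i, by
      have h1 := ehigh i
      have h2 := dk i
      omega⟩
    have hts : t s = e := by
      funext i
      have h1 := elow i
      have h2 := dle i
      simp only [t, s]
      omega
    refine ⟨s, ?_, ?_⟩
    · simp only [Finset.mem_filter, Finset.mem_univ, true_and]
      intro i
      have h1 := estep i
      have h2 := dsucc i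
      have h3 := elow i.castSucc
      have h4 := elow i.succ
      simp only [s]
      simp only [Fin.val_castSucc, Fin.val_succ] at *
      omega
    · simp only [hts]
      exact Finset.image_orderEmbOfFin_univ S hS2

theorem compat_iff {N r : ℕ} (π : Equiv.Perm (Fin (N + 1))) (s : Fin (N + 1) → Fin (r + 1)) :
    Compat π s ↔ ∀ i : Fin N,
      (s i.castSucc : ℕ) + (if π i.succ < π i.castSucc then 1 else 0) ≤ s i.succ := by
  have key : Compat π s ↔ StrictMono (fun i => toLex (s i, π i)) := by
    constructor
    · intro h i j hij
      rw [Prod.Lex.toLex_lt_toLex]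
      rcases (h.1 hij.le).eq_or_lt with h1 | h1
      · exact Or.inr ⟨h1, h.2 i j hij h1⟩
      · exact Or.inl h1
    · intro h
      constructor
      · intro i j hij
        rcases Prod.Lex.toLex_le_toLex.1 (h.monotone hij) with h1 | h1
        · exact h1.le
        · exact h1.1.le
      · intro i j hij he
        rcases Prod.Lex.toLex_lt_toLex.1 (h hij) with h1 | h1
        · exact absurd he h1.ne
        · exact h1.2
  rw [key, Fin.strictMono_iff_lt_succ]
  refine forall_congr' fun i => ?_
  rw [Prod.Lex.toLex_lt_toLex]
  have hne : π i.castSucc ≠ π i.succ := fun h => (Fin.castSucc_lt_succ (i := i)).ne (π.injective h)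
  simp only [Fin.lt_def, Fin.ext_iff, ne_eq] at *
  split_ifs <;> omega

theorem desNum_eq {N : ℕ} (π : Equiv.Perm (Fin (N + 1))) :
    desNum π = (univ.filter fun i : Fin N => π i.succ < π i.castSucc).card := by
  unfold desNum
  symm
  refine Finset.card_bij (fun i _ => i.castSucc) ?_ ?_ ?_
  · intro i hi
    simp only [Finset.mem_filter, Finset.mem_univ, true_and] at hi ⊢
    exact ⟨i.succ, by simp, hi⟩
  · intro i _ j _ h
    exact Fin.castSucc_injective _ h
  · intro i hi
    simp only [Finset.mem_filter, Finset.mem_univ, true_and] at hi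
    obtain ⟨j, h1, h2⟩ := hi
    have hiN : (i : ℕ) < N := by have := j.2; omega
    have e1 : (⟨i, hiN⟩ : Fin N).castSucc = i := Fin.ext rfl
    have e2 : (⟨i, hiN⟩ : Fin N).succ = j := Fin.ext (by simp [h1])
    refine ⟨⟨i, hiN⟩, ?_, e1⟩
    simp only [Finset.mem_filter, Finset.mem_univ, true_and]
    rw [e1, e2]; exact h2

theorem desNum_le {N : ℕ} (π : Equiv.Perm (Fin (N + 1))) : desNum π ≤ N := by
  rw [desNum_eq]
  exact (Finset.card_le_univ _).trans (by simp)

theorem invCount_zero (N k : ℕ) (h : N < k) : invCount (N + 1) k = 0 := by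
  unfold invCount
  rw [Finset.card_eq_zero, Finset.filter_eq_empty_iff]
  rintro π - ⟨-, h2⟩
  have := desNum_le π
  omega

open Classical in
theorem card_compat_one {N r : ℕ} (π : Equiv.Perm (Fin (N + 1))) :
    ((univ.filter fun s : Fin (N + 1) → Fin (r + 1) => Compat π s).card : ℤ)
      = bb (N + 1) (desNum π) r := by
  simp only [compat_iff]
  have := card_adj N r (fun i : Fin N => π i.succ < π i.castSucc)
  rw [← desNum_eq] at this
  unfold bb
  split_ifs with h
  · rw [← Nat.add_sub_assoc h, ← this]
  · rw [Nat.choose_eq_zero_of_lt (by omega)] at this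
    exact_mod_cast this

/-- extension of `invCount` to integer index -/
def iz (n : ℕ) (k : ℤ) : ℤ := if 0 ≤ k then (invCount n k.toNat : ℤ) else 0

theorem iz_nat (n k : ℕ) : iz n k = invCount n k := by simp [iz]

theorem iz_neg (n : ℕ) (k : ℤ) (h : k < 0) : iz n k = 0 := by
  simp [iz, h]

theorem iz_big (N : ℕ) (k : ℤ) (h : N < k) : iz (N + 1) k = 0 := by
  lift k to ℕ using by omega
  rw [iz_nat, invCount_zero N k (by omega)]
  rfl

theorem iz_sum (N r : ℕ) :
    ∑ k ∈ range (r + 1), iz (N + 1) k * bb (N + 1) k r = (symMat (N + 1) (r + 1)).card := by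
  classical
  rw [← card_compat]
  push_cast
  have h1 : ∀ π : Equiv.Perm (Fin (N + 1)), bb (N + 1) (desNum π) r
      = ∑ k ∈ range (r + 1), if desNum π = k then bb (N + 1) k r else 0 := by
    intro π
    rw [Finset.sum_ite_eq]
    split_ifs with h
    · rfl
    · rw [Finset.mem_range] at h
      unfold bb
      rw [if_neg (by omega)]
  rw [Finset.sum_congr rfl (fun π _ => (card_compat_one π).trans (h1 π)), Finset.sum_comm]
  refine Finset.sum_congr rfl fun k _ => ?_
  rw [← Finset.sum_filter, Finset.filter_filter, Finset.sum_const, iz_nat, invCount, nsmul_eq_mul]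

theorem iz_rec (N : ℕ) (k : ℤ) :
    ((N : ℤ) + 3) * iz (N + 3) k = (k + 1) * iz (N + 2) k + (N + 3 - k) * iz (N + 2) (k - 1)
      + ((k + 1) ^ 2 + N + 1) * iz (N + 1) k + (2 * k * (N + 2 - k) - N) * iz (N + 1) (k - 1)
      + ((N + 3 - k) ^ 2 + N + 1) * iz (N + 1) (k - 2) := by
  have := rec_of_counts (N + 1) (iz (N + 1)) (iz (N + 2)) (iz (N + 3)) (iz_neg _) (iz_neg _)
    (iz_neg _) (iz_sum N) (iz_sum (N + 1)) (iz_sum (N + 2)) k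
  push_cast at this
  linear_combination this

theorem iz_one : iz 1 0 = 1 := by
  have : invCount 1 0 = 1 := by decide
  simp [iz, this]

theorem iz_two_zero : iz 2 0 = 1 := by
  have : invCount 2 0 = 1 := by decide
  simp [iz, this]

theorem iz_two_one : iz 2 1 = 1 := by
  have : invCount 2 1 = 1 := by decide
  simp [iz, this]

theorem iz_symm (N : ℕ) : ∀ k : ℤ, iz (N + 1) (N - k) = iz (N + 1) k := by
  induction N using Nat.strong_induction_on with
  | _ N ih =>
    intro k
    match N, ih with
    | 0, _ =>
      rcases lt_trichotomy k 0 with h | h | h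
      · rw [iz_neg _ k h, iz_big 0 _ (by simpa using h)]
      · subst h; simp
      · rw [iz_big 0 k (by simpa using h), iz_neg _ _ (by simpa using h)]
    | 1, _ =>
      rcases lt_trichotomy k 0 with h | h | h
      · rw [iz_neg _ k h, iz_big 1 _ (by push_cast; omega)]
      · subst h; simp [iz_two_zero, iz_two_one]
      · rcases eq_or_lt_of_le (show 1 ≤ k from h) with h1 | h1
        · subst h1; simp [iz_two_zero, iz_two_one]
        · rw [iz_big 1 k (by push_cast; omega), iz_neg _ _ (by push_cast; omega)]
    | (N + 2), ih =>
      have r1 := iz_rec N k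
      have r2 := iz_rec N (N + 2 - k)
      have a1 := ih (N + 1) (by omega) k
      have a2 := ih (N + 1) (by omega) (k - 1)
      have b0 := ih N (by omega) k
      have b1 := ih N (by omega) (k - 1)
      have b2 := ih N (by omega) (k - 2)
      push_cast at *
      rw [show (N : ℤ) + 1 - (k - 1) = N + 2 - k by ring] at a2
      rw [show (N : ℤ) - (k - 1) = N + 2 - k - 1 by ring] at b1
      rw [show (N : ℤ) - (k - 2) = N + 2 - k by ring] at b2
      rw [show (N : ℤ) + 1 - k = N + 2 - k - 1 by ring] at a1
      rw [show (N : ℤ) - k = N + 2 - k - 2 by ring] at b0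
      rw [show N + 1 + 1 = N + 2 by rfl] at a1 a2
      rw [a1, a2, b0, b1, b2] at r2
      have h3 : ((N : ℤ) + 3) * iz (N + 3) (N + 2 - k) = (N + 3) * iz (N + 3) k := by
        rw [r1, r2]; ring
      exact mul_left_cancel₀ (by positivity) h3

theorem iz_nonneg (n : ℕ) (k : ℤ) : 0 ≤ iz n k := by
  unfold iz; split_ifs <;> positivity

theorem iz_up (N : ℕ) : ∀ k : ℤ, 2 * k ≤ N → iz (N + 1) (k - 1) ≤ iz (N + 1) k := by
  induction N using Nat.strong_induction_on with
  | _ N ih =>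
    intro k hk
    rcases le_or_gt k 0 with hk0 | hk0
    · rw [iz_neg _ (k - 1) (by omega)]
      exact iz_nonneg _ _
    match N, ih with
    | 0, _ => omega
    | 1, _ => omega
    | (N + 2), ih =>
      push_cast at hk
      have r1 := iz_rec N k
      have r2 := iz_rec N (k - 1)
      rw [show k - 1 - 1 = k - 2 by ring, show k - 1 - 2 = k - 3 by ring] at r2
      have ihA : ∀ j : ℤ, 2 * j ≤ N + 1 → iz (N + 2) (j - 1) ≤ iz (N + 2) j :=
        fun j hj => ih (N + 1) (by omega) j (by push_cast; exact hj)
      have ihB := ih N (by omega)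
      have symA : ∀ j : ℤ, iz (N + 2) (N + 1 - j) = iz (N + 2) j := fun j => by
        have := iz_symm (N + 1) j
        push_cast at this
        exact this
      have symB := iz_symm N
      have A1 : iz (N + 2) (k - 1) ≤ iz (N + 2) k := by
        rcases le_or_gt (2 * k) (N + 1) with h | h
        · exact ihA k h
        · rw [← symA k, show (N : ℤ) + 1 - k = k - 1 by omega]
      have A2 : iz (N + 2) (k - 2) ≤ iz (N + 2) (k - 1) := by
        have := ihA (k - 1) (by omega)
        rwa [show k - 1 - 1 = k - 2 by ring] at this
      have B1 : iz (N + 1) (k - 2) ≤ iz (N + 1) (k - 1) := by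
        have := ihB (k - 1) (by omega)
        rwa [show k - 1 - 1 = k - 2 by ring] at this
      have B2 : iz (N + 1) (k - 3) ≤ iz (N + 1) (k - 2) := by
        have := ihB (k - 2) (by omega)
        rwa [show k - 2 - 1 = k - 3 by ring] at this
      have P3 : 0 ≤ (((N : ℤ) + 4 - k) ^ 2 + N + 1) * (iz (N + 1) (k - 2) - iz (N + 1) (k - 3)) :=
        mul_nonneg (by positivity) (sub_nonneg.2 B2)
      have PA1 : 0 ≤ (k + 1) * (iz (N + 2) k - iz (N + 2) (k - 1)) :=
        mul_nonneg (by omega) (sub_nonneg.2 A1)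
      have PA2 : 0 ≤ ((N : ℤ) + 4 - k) * (iz (N + 2) (k - 1) - iz (N + 2) (k - 2)) :=
        mul_nonneg (by omega) (sub_nonneg.2 A2)
      suffices hmain : 0 ≤ ((k + 1) ^ 2 + N + 1) * (iz (N + 1) k - iz (N + 1) (k - 1))
          + (2 * k * (N + 3 - k) - N + 1) * (iz (N + 1) (k - 1) - iz (N + 1) (k - 2))
          + (((N : ℤ) + 4 - k) ^ 2 + N + 1) * (iz (N + 1) (k - 2) - iz (N + 1) (k - 3)) by
        have h3 : ((N : ℤ) + 3) * iz (N + 3) (k - 1) ≤ (N + 3) * iz (N + 3) k := by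
          rw [r1, r2]
          linarith
        exact le_of_mul_le_mul_left h3 (by positivity)
      have hc : 0 ≤ 2 * k * (N + 3 - k) - N + 1 := by nlinarith
      rcases le_or_gt (2 * k) (N + 1) with h | h
      · have B0 : iz (N + 1) (k - 1) ≤ iz (N + 1) k := by
          rcases le_or_gt (2 * k) N with h | h
          · exact ihB k h
          · rw [← symB k, show (N : ℤ) - k = k - 1 by omega]
        have P1 : 0 ≤ ((k + 1) ^ 2 + N + 1) * (iz (N + 1) k - iz (N + 1) (k - 1)) :=
          mul_nonneg (by positivity) (sub_nonneg.2 B0)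
        have P2 := mul_nonneg hc (sub_nonneg.2 B1)
        linarith
      · have hN : (N : ℤ) = 2 * k - 2 := by omega
        have B0 : iz (N + 1) k = iz (N + 1) (k - 2) := by
          rw [← symB k, hN]; congr 1; ring
        rw [B0]
        by_cases hk2 : k = 2
        · subst hk2
          have hN2 : N = 2 := by omega
          subst hN2
          have v0 : iz 3 0 = 1 := by
            have : invCount 3 0 = 1 := by decide
            simp [iz, this]
          have v1 : iz 3 1 = 2 := by
            have : invCount 3 1 = 2 := by decide
            simp [iz, this]
          norm_num [v0, v1, iz_neg]
        · have hc1 : 0 ≤ (k - 1) * (k - 3) := by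
            rcases lt_or_gt_of_ne hk2 with h | h
            · have : k = 1 := by omega
              simp [this]
            · exact mul_nonneg (by omega) (by omega)
          have P2 := mul_nonneg hc1 (sub_nonneg.2 B1)
          rw [hN] at P3 ⊢
          linarith

/-- Unimodality of the sequence `I_{n,0}, …, I_{n,n-1}`. -/
theorem invCount_unimodal (n : ℕ) (hn : 1 ≤ n) :
    (∀ k, 1 ≤ k → 2 * k ≤ n - 1 → invCount n (k - 1) ≤ invCount n k) ∧
    (∀ k, n - 1 ≤ 2 * k → k ≤ n - 2 → invCount n (k + 1) ≤ invCount n k) := by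
  obtain ⟨N, rfl⟩ : ∃ N, n = N + 1 := ⟨n - 1, by omega⟩
  constructor
  · intro k h1 h2
    have := iz_up N k (by omega)
    rw [show (k : ℤ) - 1 = ((k - 1 : ℕ) : ℤ) by omega, iz_nat, iz_nat] at this
    exact_mod_cast this
  · intro k h1 h2
    have := iz_up N (N - k) (by omega)
    rw [iz_symm, show (N : ℤ) - k - 1 = N - ((k + 1 : ℕ) : ℤ) by push_cast; ring, iz_symm,
      iz_nat, iz_nat] at this
    exact_mod_cast this
end

section
/- For every n ≥ 1, the formal power series identity J_{2n}(t)/(1-t)^{2n+1} = ∑_{r=0}^{∞} C(r(r+1)/2 + n - 1, n) t^r holds in ℚ[[t]], where J_{2n}(t) = ∑_{k} J_{2n,k} t^k. -/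
open Finset Polynomial

namespace JGF

/-- Position `i` is a descent of `π`. -/
def IsDes {N : ℕ} (π : Equiv.Perm (Fin N)) (i : ℕ) : Prop :=
  ∃ a b : Fin N, (a : ℕ) = i ∧ (b : ℕ) = i + 1 ∧ π b < π a

open Classical in
/-- Number of non-descents before `m`. -/
noncomputable def nd {N : ℕ} (π : Equiv.Perm (Fin N)) (m : ℕ) : ℕ :=
  ((Finset.range m).filter fun i => ¬ IsDes π i).card

/-- `f` is weakly increasing, and `π` is increasing on the blocks of `f`. -/
def Q {N r : ℕ} (π : Equiv.Perm (Fin N)) (f : Fin N → Fin (r + 1)) : Prop :=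
  Monotone f ∧ ∀ i j, i < j → f i = f j → π i < π j

lemma nd_succ_des {N : ℕ} (π : Equiv.Perm (Fin N)) (m : ℕ) (h : IsDes π m) :
    nd π (m + 1) = nd π m := by
  classical
  simp [nd, Finset.range_add_one, Finset.filter_insert, h]

lemma nd_succ_not {N : ℕ} (π : Equiv.Perm (Fin N)) (m : ℕ) (h : ¬ IsDes π m) :
    nd π (m + 1) = nd π m + 1 := by
  classical
  simp [nd, Finset.range_add_one, Finset.filter_insert, h]

lemma nd_zero {N : ℕ} (π : Equiv.Perm (Fin N)) : nd π 0 = 0 := by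
  simp [nd]

lemma nd_last {K : ℕ} (π : Equiv.Perm (Fin (K + 1))) : nd π K + desNum π = K := by
  classical
  have h : desNum π = ((Finset.range K).filter fun i => IsDes π i).card := by
    unfold desNum
    apply Finset.card_bij (fun (a : Fin (K + 1)) _ => (a : ℕ))
    · rintro a ha
      simp only [Finset.mem_filter, Finset.mem_univ, true_and] at ha
      obtain ⟨j, hj, hlt⟩ := ha
      simp only [Finset.mem_filter, Finset.mem_range]
      exact ⟨by omega, a, j, rfl, hj, hlt⟩
    · intro a _ b _ hab
      exact Fin.ext hab
    · intro b hb
      simp only [Finset.mem_filter, Finset.mem_range] at hb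
      obtain ⟨_, a, j, ha, hj, hlt⟩ := hb
      exact ⟨a, by simpa using ⟨j, by omega, hlt⟩, ha⟩
  have := Finset.card_filter_add_card_filter_not (s := Finset.range K) (fun i => IsDes π i)
  rw [Finset.card_range] at this
  rw [h, nd]
  omega

lemma Q_iff {K r : ℕ} (π : Equiv.Perm (Fin (K + 1))) (f : Fin (K + 1) → Fin (r + 1)) :
    Q π f ↔ StrictMono (fun i => (f i : ℕ) + nd π i) := by
  constructor
  · rintro ⟨hm, hs⟩
    rw [Fin.strictMono_iff_lt_succ]
    intro i
    have h1 : f i.castSucc ≤ f i.succ := hm (Fin.castSucc_lt_succ (i := i)).le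
    have h1' : (f i.castSucc : ℕ) ≤ f i.succ := h1
    simp only [Fin.val_castSucc, Fin.val_succ]
    by_cases hd : IsDes π i
    · rw [nd_succ_des π _ hd]
      have : f i.castSucc ≠ f i.succ := by
        intro he
        have h2 := hs _ _ (Fin.castSucc_lt_succ (i := i)) he
        obtain ⟨a, b, ha, hb, hlt⟩ := hd
        have ea : a = i.castSucc := Fin.ext ha
        have eb : b = i.succ := Fin.ext (by simpa using hb)
        subst ea eb
        exact absurd hlt h2.asymm
      have h3 : (f i.castSucc : ℕ) ≠ f i.succ := fun h => this (Fin.ext h)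
      omega
    · rw [nd_succ_not π _ hd]
      omega
  · intro h
    have h' := Fin.strictMono_iff_lt_succ.1 h
    have hm : Monotone f := by
      rw [Fin.monotone_iff_le_succ]
      intro i
      have := h' i
      simp only [Fin.val_castSucc, Fin.val_succ] at this
      rw [Fin.le_def]
      by_cases hd : IsDes π i
      · rw [nd_succ_des π _ hd] at this; omega
      · rw [nd_succ_not π _ hd] at this; omega
    refine ⟨hm, ?_⟩
    have key : ∀ t i : ℕ, ∀ (hi : i + t + 1 < K + 1),
        f ⟨i, by omega⟩ = f ⟨i + t + 1, hi⟩ → π ⟨i, by omega⟩ < π ⟨i + t + 1, hi⟩ := by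
      intro t
      induction t with
      | zero =>
        intro i hi he
        have := h' ⟨i, by omega⟩
        simp only [Fin.castSucc_mk, Fin.succ_mk] at this
        by_cases hd : IsDes π i
        · rw [nd_succ_des π _ hd] at this
          simp only [Nat.add_zero] at he
          rw [he] at this
          omega
        · by_contra hlt
          apply hd
          refine ⟨⟨i, by omega⟩, ⟨i + 0 + 1, hi⟩, rfl, rfl, lt_of_le_of_ne (not_lt.1 hlt) ?_⟩
          intro he
          have := π.injective he
          simp at this
      | succ t ih =>
        intro i hi he
        have e1 : f ⟨i, by omega⟩ ≤ f ⟨i + t + 1, by omega⟩ := hm (Fin.mk_le_mk.2 (by omega))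
        have e2 : f ⟨i + t + 1, by omega⟩ ≤ f ⟨i + (t + 1) + 1, hi⟩ :=
          hm (Fin.mk_le_mk.2 (by omega))
        have e3 : f ⟨i, by omega⟩ = f ⟨i + t + 1, by omega⟩ := le_antisymm e1 (he ▸ e2)
        refine (ih i (by omega) e3).trans ?_
        have := h' ⟨i + t + 1, by omega⟩
        simp only [Fin.castSucc_mk, Fin.succ_mk] at this
        have e4 : f ⟨i + t + 1, by omega⟩ = f ⟨i + t + 1 + 1, by omega⟩ := e3.symm.trans he
        by_cases hd : IsDes π (i + t + 1)
        · rw [nd_succ_des π _ hd, e4] at this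
          omega
        · by_contra hlt
          apply hd
          refine ⟨⟨i + t + 1, by omega⟩, ⟨i + (t + 1) + 1, hi⟩, rfl, rfl,
            lt_of_le_of_ne (not_lt.1 hlt) ?_⟩
          intro he
          have := π.injective he
          simp at this
    intro i j hij he
    have hij' : (i : ℕ) < j := hij
    obtain ⟨t, ht⟩ : ∃ t, (j : ℕ) = i + t + 1 := ⟨j - i - 1, by omega⟩
    have hj : j = ⟨i + t + 1, by omega⟩ := Fin.ext ht
    have := key t i (by omega)
    rw [← hj] at this
    exact this he

lemma nd_le {N : ℕ} (π : Equiv.Perm (Fin N)) (m : ℕ) : nd π m ≤ m := by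
  classical
  exact (Finset.card_filter_le _ _).trans (by simp)

open Classical in
lemma card_strictMono (N M : ℕ) :
    (Finset.univ.filter fun g : Fin N → Fin M => StrictMono g).card = M.choose N := by
  have e : {g : Fin N → Fin M // StrictMono g} ≃ (Fin N ↪o Fin M) :=
    { toFun := fun g => OrderEmbedding.ofStrictMono g.1 g.2
      invFun := fun g => ⟨g, g.strictMono⟩
      left_inv := fun g => rfl
      right_inv := fun g => rfl }
  rw [← Fintype.card_subtype, ← Nat.card_eq_fintype_card, Nat.card_congr e,
    Nat.card_congr Set.powersetCard.ofFinEmbEquiv, Set.powersetCard.card]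
  simp

open Classical in
lemma card_Q {K r : ℕ} (π : Equiv.Perm (Fin (K + 1))) :
    (Finset.univ.filter fun f : Fin (K + 1) → Fin (r + 1) => Q π f).card
      = (K + 1 + r - desNum π).choose (K + 1) := by
  rw [← card_strictMono]
  have hl := nd_last π
  have hmono : Monotone (nd π) := monotone_nat_of_le_succ (fun m => by
    by_cases hd : IsDes π m
    · rw [nd_succ_des π _ hd]
    · rw [nd_succ_not π _ hd]; omega)
  apply Finset.card_bij (fun (f : Fin (K + 1) → Fin (r + 1)) _ (i : Fin (K + 1)) => (Fin.ofNat (K + r + 1 - desNum π - 1 + 1)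
    ((f i : ℕ) + nd π i)).cast (by omega))
  · intro f hf
    simp only [Finset.mem_filter, Finset.mem_univ, true_and] at hf ⊢
    rw [Q_iff] at hf
    intro i j hij
    have := hf hij
    have hb : ∀ i : Fin (K + 1), (f i : ℕ) + nd π i < K + r + 1 - desNum π - 1 + 1 := by
      intro i
      have := hmono (show (i : ℕ) ≤ K by omega)
      have := (f i).2
      omega
    simp only [Fin.lt_def, Fin.val_cast, Fin.ofNat]
    rw [Nat.mod_eq_of_lt (hb i), Nat.mod_eq_of_lt (hb j)]
    exact this
  · intro f hf g hg hfg
    funext i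
    have := congrFun hfg i
    have hb : ∀ f : Fin (K + 1) → Fin (r + 1),
        (f i : ℕ) + nd π i < K + r + 1 - desNum π - 1 + 1 := by
      intro f
      have := hmono (show (i : ℕ) ≤ K by omega)
      have := (f i).2
      omega
    simp only [Fin.ext_iff, Fin.val_cast, Fin.ofNat] at this
    rw [Nat.mod_eq_of_lt (hb f), Nat.mod_eq_of_lt (hb g)] at this
    exact Fin.ext (by omega)
  · intro g hg
    simp only [Finset.mem_filter, Finset.mem_univ, true_and] at hg
    have hge : ∀ i : ℕ, ∀ h : i < K + 1, i ≤ g ⟨i, h⟩ := by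
      intro i
      induction i with
      | zero => intro _; omega
      | succ i ih =>
        intro h
        have h1 := ih (by omega)
        have h2 : g ⟨i, by omega⟩ < g ⟨i + 1, h⟩ := hg (by rw [Fin.lt_def]; simp)
        rw [Fin.lt_def] at h2
        omega
    have hge' : ∀ i : Fin (K + 1), nd π i ≤ g i := fun i => (nd_le π i).trans (hge i i.2)
    have hmon : Monotone (fun i : Fin (K + 1) => (g i : ℕ) - nd π i) := by
      rw [Fin.monotone_iff_le_succ]
      intro i
      have h2 : g i.castSucc < g i.succ := hg (Fin.castSucc_lt_succ (i := i))
      rw [Fin.lt_def] at h2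
      simp only [Fin.val_castSucc, Fin.val_succ]
      by_cases hd : IsDes π i
      · rw [nd_succ_des π _ hd]; omega
      · rw [nd_succ_not π _ hd]; omega
    have hle : ∀ i : Fin (K + 1), (g i : ℕ) - nd π i < r + 1 := by
      intro i
      have h1 := hmon (Fin.le_last i)
      have h2 := (g (Fin.last K)).2
      have h3 := hge' (Fin.last K)
      simp only [Fin.val_last] at h1 h3
      omega
    refine ⟨fun i => ⟨(g i : ℕ) - nd π i, hle i⟩, ?_, ?_⟩
    · simp only [Finset.mem_filter, Finset.mem_univ, true_and]
      rw [Q_iff]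
      intro i j hij
      have h1 := hge' i
      have h2 := hge' j
      have h3 := hg hij
      rw [Fin.lt_def] at h3
      simp only
      omega
    · funext i
      have h1 := hge' i
      have h2 := (g i).2
      simp only [Fin.ext_iff, Fin.val_cast, Fin.ofNat]
      rw [Nat.mod_eq_of_lt] <;> omega

section Pairs

variable {r : ℕ}

/-- Swap the two entries of a pair. -/
def sw (p : Fin (r + 1) ×ₗ Fin (r + 1)) : Fin (r + 1) ×ₗ Fin (r + 1) :=
  toLex ((ofLex p).2, (ofLex p).1)

lemma sw_sw (p : Fin (r + 1) ×ₗ Fin (r + 1)) : sw (sw p) = p := rfl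

/-- Strictly increasing pair. -/
def up (p : Fin (r + 1) ×ₗ Fin (r + 1)) : Prop := (ofLex p).1 < (ofLex p).2

instance : DecidablePred (up (r := r)) := fun p =>
  inferInstanceAs (Decidable ((ofLex p).1 < (ofLex p).2))

/-- The word of pairs attached to `(π, f)`. -/
def word {N : ℕ} (π : Equiv.Perm (Fin N)) (f : Fin N → Fin (r + 1)) (m : Fin N) :
    Fin (r + 1) ×ₗ Fin (r + 1) := toLex (f m, f (π m))

/-- The multiset of pairs. -/
def Amul {N : ℕ} (π : Equiv.Perm (Fin N)) (f : Fin N → Fin (r + 1)) :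
    Multiset (Fin (r + 1) ×ₗ Fin (r + 1)) :=
  (Finset.univ : Finset (Fin N)).val.map (word π f)

/-- Good pairs. -/
def Good {N : ℕ} (π : Equiv.Perm (Fin N)) (f : Fin N → Fin (r + 1)) : Prop :=
  π * π = 1 ∧ (∀ i, π i ≠ i) ∧ Q π f

lemma mono_unique {L : Type*} [LinearOrder L] {N : ℕ} {s t : Fin N → L}
    (hs : Monotone s) (ht : Monotone t)
    (h : (Finset.univ : Finset (Fin N)).val.map s = (Finset.univ : Finset (Fin N)).val.map t) :
    s = t := by
  rw [Fin.univ_val_map, Fin.univ_val_map, Multiset.coe_eq_coe] at h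
  exact List.ofFn_injective (List.Perm.eq_of_sortedLE hs.sortedLE_ofFn ht.sortedLE_ofFn h)

lemma mono_exists {L : Type*} [LinearOrder L] {N : ℕ} (A : Multiset L) (hA : A.card = N) :
    ∃ s : Fin N → L, Monotone s ∧ (Finset.univ : Finset (Fin N)).val.map s = A := by
  subst hA
  induction A using Quotient.inductionOn with
  | h l =>
    have h1 : (Finset.univ : Finset (Fin l.length)).val.map l.get = (l : Multiset L) := by
      rw [Fin.univ_val_map, List.ofFn_get]
    refine ⟨l.get ∘ Tuple.sort l.get, Tuple.monotone_sort _, ?_⟩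
    have h2 := (Tuple.sort l.get).ofFn_comp_perm l.get
    rw [Fin.univ_val_map]
    refine (Multiset.coe_eq_coe.2 h2).trans ?_
    rw [← Fin.univ_val_map]
    exact h1

lemma inv_app {N : ℕ} {π : Equiv.Perm (Fin N)} (h : π * π = 1) (m : Fin N) : π (π m) = m := by
  have := congrArg (fun σ : Equiv.Perm (Fin N) => σ m) h
  simpa using this

lemma word_perm {N : ℕ} {π : Equiv.Perm (Fin N)} {f : Fin N → Fin (r + 1)} (h : π * π = 1)
    (m : Fin N) : word π f (π m) = sw (word π f m) := by
  simp [word, sw, inv_app h]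

lemma word_mono {N : ℕ} {π : Equiv.Perm (Fin N)} {f : Fin N → Fin (r + 1)} (h : Q π f) :
    Monotone (word π f) := by
  rw [monotone_iff_forall_lt]
  intro i j hij
  rw [word, word, Prod.Lex.toLex_le_toLex]
  rcases (h.1 hij.le).lt_or_eq with h1 | h1
  · exact Or.inl h1
  · exact Or.inr ⟨h1, h.1 (h.2 i j hij h1).le⟩

lemma word_off {N : ℕ} {π : Equiv.Perm (Fin N)} {f : Fin N → Fin (r + 1)} (h : Good π f)
    (m : Fin N) : f m ≠ f (π m) := by
  obtain ⟨hi, hf, hq⟩ := h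
  intro he
  rcases lt_trichotomy m (π m) with h1 | h1 | h1
  · have := hq.2 _ _ h1 he
    rw [inv_app hi] at this
    exact absurd h1 this.asymm
  · exact hf m h1.symm
  · have := hq.2 _ _ h1 he.symm
    rw [inv_app hi] at this
    exact absurd h1 this.asymm

lemma word_sort {N : ℕ} {π : Equiv.Perm (Fin N)} {f : Fin N → Fin (r + 1)} (h : Good π f) :
    π = Tuple.sort (sw ∘ word π f) := by
  obtain ⟨hi, hf, hq⟩ := h
  have e : (sw ∘ word π f) ∘ π = word π f := by
    funext m
    simp [word_perm hi, sw_sw]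
  rw [Tuple.eq_sort_iff, e]
  refine ⟨word_mono hq, ?_⟩
  intro i j hij he
  have e1 : word π f i = word π f j := by
    rw [← e]; exact he
  apply hq.2 i j hij
  exact congrArg (fun p => (ofLex p).1) e1

lemma map_sw_Amul {N : ℕ} {π : Equiv.Perm (Fin N)} {f : Fin N → Fin (r + 1)} (hi : π * π = 1) :
    (Amul π f).map sw = Amul π f := by
  unfold Amul
  rw [Multiset.map_map]
  have e : sw ∘ word π f = word π f ∘ π := by
    funext m
    simp [word_perm hi]
  rw [e, ← Multiset.map_map]
  congr 1
  have := congrArg Finset.val (Finset.map_univ_equiv π)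
  simpa using this

lemma decomp (A : Multiset (Fin (r + 1) ×ₗ Fin (r + 1))) (h : A.map sw = A)
    (ho : ∀ p ∈ A, (ofLex p).1 ≠ (ofLex p).2) :
    A = A.filter up + (A.filter up).map sw := by
  conv_lhs => rw [← Multiset.filter_add_not up A]
  congr 1
  conv_lhs => rw [← h]
  rw [Multiset.filter_map]
  congr 1
  apply Multiset.filter_congr
  intro p hp
  have := ho p hp
  simp only [Function.comp, up, sw, ofLex_toLex, not_lt]
  exact ⟨fun h => lt_of_le_of_ne h this, le_of_lt⟩

lemma Amul_off {N : ℕ} {π : Equiv.Perm (Fin N)} {f : Fin N → Fin (r + 1)} (h : Good π f) :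
    ∀ p ∈ Amul π f, (ofLex p).1 ≠ (ofLex p).2 := by
  intro p hp
  simp only [Amul, Multiset.mem_map] at hp
  obtain ⟨m, _, rfl⟩ := hp
  exact word_off h m

lemma inj {N : ℕ} {π π' : Equiv.Perm (Fin N)} {f f' : Fin N → Fin (r + 1)} (h : Good π f)
    (h' : Good π' f') (he : (Amul π f).filter up = (Amul π' f').filter up) :
    π = π' ∧ f = f' := by
  have hA : Amul π f = Amul π' f' := by
    rw [decomp _ (map_sw_Amul h.1) (Amul_off h), decomp _ (map_sw_Amul h'.1) (Amul_off h'), he]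
  have hw : word π f = word π' f' := mono_unique (word_mono h.2.2) (word_mono h'.2.2) hA
  constructor
  · rw [word_sort h, word_sort h', hw]
  · funext m
    exact congrArg (fun p => (ofLex p).1) (congrFun hw m)

lemma surj {n : ℕ} (B : Multiset (Fin (r + 1) ×ₗ Fin (r + 1))) (hB : B.card = n)
    (hu : ∀ p ∈ B, up p) :
    ∃ (π : Equiv.Perm (Fin (2 * n))) (f : Fin (2 * n) → Fin (r + 1)),
      Good π f ∧ (Amul π f).filter up = B := by
  obtain ⟨s, hs, hA⟩ := mono_exists (N := 2 * n) (B + B.map sw) (by simp [hB]; ring)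
  have hoff : ∀ m, (ofLex (s m)).1 ≠ (ofLex (s m)).2 := by
    intro m
    have : s m ∈ B + B.map sw := by
      rw [← hA]
      exact Multiset.mem_map_of_mem _ (Finset.mem_univ m)
    rw [Multiset.mem_add, Multiset.mem_map] at this
    rcases this with h | ⟨p, hp, h⟩
    · exact (hu _ h).ne
    · rw [← h]
      exact (hu _ hp).ne'
  obtain ⟨π, hπ⟩ : ∃ π, π = Tuple.sort (sw ∘ s) := ⟨_, rfl⟩
  obtain ⟨hm, ht⟩ := Tuple.eq_sort_iff.1 hπ
  have e : (sw ∘ s) ∘ π = s := by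
    apply mono_unique hm hs
    have h1 : (Finset.univ : Finset (Fin (2 * n))).val.map π = Finset.univ.val := by
      have := congrArg Finset.val (Finset.map_univ_equiv π)
      simpa using this
    rw [← Multiset.map_map, h1, ← Multiset.map_map, hA, Multiset.map_add, Multiset.map_map]
    have : (sw ∘ sw : Fin (r + 1) ×ₗ Fin (r + 1) → _) = id := rfl
    rw [this, Multiset.map_id]
    exact add_comm _ _
  have e1 : ∀ m, s (π m) = sw (s m) := by
    intro m
    have := congrFun e m
    simp only [Function.comp] at this
    rw [← this, sw_sw]
  have ht' : ∀ i j, i < j → s i = s j → π i < π j := by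
    intro i j hij h
    apply ht i j hij
    simp only [Function.comp, e1, h]
  have hinv : π⁻¹ = π := by
    conv_rhs => rw [hπ]
    have e2 : (sw ∘ s) ∘ ⇑π⁻¹ = s := by
      funext m
      simp only [Function.comp]
      rw [← e1]
      simp
    rw [Tuple.eq_sort_iff, e2]
    refine ⟨hs, ?_⟩
    intro i j hij h
    have h' : s i = s j := by
      rw [← e2]; exact h
    by_contra hlt
    rcases (not_lt.1 hlt).lt_or_eq with h3 | h3
    · have h4 : s (π⁻¹ j) = s (π⁻¹ i) := by
        have q : ∀ m, s (π⁻¹ m) = sw (s m) := by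
          intro m
          have := e1 (π⁻¹ m)
          rw [← Equiv.Perm.mul_apply, mul_inv_cancel, Equiv.Perm.one_apply] at this
          rw [this, sw_sw]
        rw [q, q, h']
      have := ht' _ _ h3 h4
      simp at this
      exact absurd hij this.asymm
    · exact hij.ne' (π⁻¹.injective h3)
  have hi : π * π = 1 := by
    nth_rewrite 1 [← hinv]
    simp
  have hmon : Monotone (fun m => (ofLex (s m)).1) := by
    intro i j hij
    have := hs hij
    rw [Prod.Lex.le_iff] at this
    rcases this with h | h
    · exact h.le
    · exact h.1.le
  have hword : word π (fun m => (ofLex (s m)).1) = s := by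
    funext m
    simp only [word, e1]
    rfl
  refine ⟨π, fun m => (ofLex (s m)).1, ⟨hi, ?_, hmon, ?_⟩, ?_⟩
  · intro m hm'
    have := e1 m
    rw [hm'] at this
    exact hoff m (congrArg (fun p => (ofLex p).1) this)
  · intro i j hij h
    have h1 := hs hij.le
    rw [Prod.Lex.le_iff] at h1
    rcases h1 with h1 | ⟨_, h1⟩
    · exact absurd h h1.ne
    · rcases h1.lt_or_eq with h2 | h2
      · have a1 : (ofLex (s (π i))).1 < (ofLex (s (π j))).1 := by
          rw [e1, e1]; exact h2
        by_contra hlt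
        exact absurd a1 (not_lt.2 (hmon (not_lt.1 hlt)))
      · apply ht' i j hij
        exact congrArg toLex (Prod.ext h h2)
  · unfold Amul
    rw [hword, hA, Multiset.filter_add, Multiset.filter_eq_self.2 hu, Multiset.filter_map]
    have : Multiset.filter (up ∘ sw) B = 0 := by
      rw [Multiset.filter_eq_nil]
      intro p hp h
      exact absurd (hu p hp) (lt_asymm h)
    rw [this]
    simp

lemma card_up : Fintype.card {p : Fin (r + 1) ×ₗ Fin (r + 1) // up p} = r * (r + 1) / 2 := by
  have e : {p : Fin (r + 1) ×ₗ Fin (r + 1) // up p} ≃ (Σ j : Fin (r + 1), Fin j) :=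
    { toFun := fun p => ⟨(ofLex p.1).2, ⟨(ofLex p.1).1, p.2⟩⟩
      invFun := fun q => ⟨toLex (⟨q.2, q.2.2.trans q.1.2⟩, q.1), q.2.2⟩
      left_inv := fun p => rfl
      right_inv := fun q => rfl }
  rw [Fintype.card_congr e, Fintype.card_sigma]
  simp only [Fintype.card_fin]
  rw [Fin.sum_univ_eq_sum_range (fun i => i), Finset.sum_range_id]
  simp [mul_comm]

open Classical in
lemma card_Good (n r : ℕ) :
    (Finset.univ.filter fun x : Equiv.Perm (Fin (2 * n)) × (Fin (2 * n) → Fin (r + 1)) =>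
      Good x.1 x.2).card = (r * (r + 1) / 2 + n - 1).choose n := by
  rw [← card_up, ← Sym.card_sym_eq_choose, ← Finset.card_univ]
  have h1 : Function.Injective
      (fun B : Sym {p : Fin (r + 1) ×ₗ Fin (r + 1) // up p} n =>
        (B : Multiset {p : Fin (r + 1) ×ₗ Fin (r + 1) // up p}).map Subtype.val) :=
    fun _ _ h => Sym.coe_injective (Multiset.map_injective Subtype.val_injective h)
  rw [← Finset.card_image_of_injective Finset.univ h1]
  rw [← Finset.card_image_of_injOn (f := fun x => (Amul x.1 x.2).filter up)]
  · congr 1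
    ext B
    simp only [Finset.mem_image, Finset.mem_filter, Finset.mem_univ, true_and]
    constructor
    · rintro ⟨⟨π, f⟩, hg, rfl⟩
      simp only at hg ⊢
      have hc : ((Amul π f).filter up).card = n := by
        have := congrArg Multiset.card (decomp _ (map_sw_Amul hg.1) (Amul_off hg))
        simp only [Multiset.card_add, Multiset.card_map] at this
        have h2 : (Amul π f).card = 2 * n := by simp [Amul]
        omega
      have hu : ∀ p ∈ (Amul π f).filter up, up p := fun p hp => (Multiset.mem_filter.1 hp).2
      refine ⟨⟨((Amul π f).filter up).attach.map (fun p => ⟨p.1, hu p.1 p.2⟩), by simpa using hc⟩, ?_⟩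
      simp [Multiset.map_map]
    · rintro ⟨B, rfl⟩
      obtain ⟨π, f, hg, h⟩ := surj (n := n) (B.1.map Subtype.val)
        (by rw [Multiset.card_map]; exact B.2)
        (by intro p hp
            obtain ⟨q, _, rfl⟩ := Multiset.mem_map.1 hp
            exact q.2)
      exact ⟨(π, f), hg, h⟩
  · rintro ⟨π, f⟩ h ⟨π', f'⟩ h' he
    simp only [Finset.coe_filter, Finset.mem_univ, true_and, Set.mem_setOf_eq] at h h'
    obtain ⟨rfl, rfl⟩ := inj h h' he
    rfl

end Pairs

lemma count (n r : ℕ) (hn : 1 ≤ n) :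
    (r * (r + 1) / 2 + n - 1).choose n
      = ∑ k ∈ Finset.range (r + 1), fpfInvCount (2 * n) k * (2 * n + (r - k)).choose (2 * n) := by
  classical
  rw [← card_Good]
  obtain ⟨K, hK⟩ : ∃ K, 2 * n = K + 1 := ⟨2 * n - 1, by omega⟩
  rw [hK]
  let S := Finset.univ.filter fun π : Equiv.Perm (Fin (K + 1)) => π * π = 1 ∧ ∀ i, π i ≠ i
  have h1 : (Finset.univ.filter fun x : Equiv.Perm (Fin (K + 1)) × (Fin (K + 1) → Fin (r + 1)) =>
      Good x.1 x.2).card = ∑ π ∈ S, (K + 1 + r - desNum π).choose (K + 1) := by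
    simp only [← card_Q, S]
    rw [← Finset.card_sigma]
    apply Finset.card_bij (fun x _ => ⟨x.1, x.2⟩)
    · rintro ⟨π, f⟩ h
      simp only [Finset.mem_filter, Finset.mem_univ, true_and, Finset.mem_sigma] at h ⊢
      exact ⟨⟨h.1, h.2.1⟩, h.2.2⟩
    · rintro ⟨π, f⟩ _ ⟨π', f'⟩ _ h
      simpa using h
    · rintro ⟨π, f⟩ h
      simp only [Finset.mem_filter, Finset.mem_univ, true_and, Finset.mem_sigma] at h
      exact ⟨(π, f), Finset.mem_filter.2 ⟨Finset.mem_univ _, h.1.1, h.1.2, h.2⟩, rfl⟩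
  rw [h1]
  have h2 : ∀ k, fpfInvCount (K + 1) k = (S.filter fun π => desNum π = k).card := by
    intro k
    simp only [fpfInvCount, S, Finset.filter_filter, and_assoc]
  simp only [h2]
  have h3 : ∑ π ∈ S, (K + 1 + r - desNum π).choose (K + 1)
      = ∑ π ∈ S with desNum π ∈ Finset.range (r + 1), (K + 1 + r - desNum π).choose (K + 1) := by
    symm
    apply Finset.sum_filter_of_ne
    intro π _ hne
    rw [Finset.mem_range]
    by_contra hlt
    apply hne
    apply Nat.choose_eq_zero_of_lt
    omega
  rw [h3, ← Finset.sum_fiberwise_of_maps_to (s := S.filter fun π => desNum π ∈ Finset.range (r + 1))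
    (t := Finset.range (r + 1)) (g := desNum) (fun π hπ => (Finset.mem_filter.1 hπ).2)]
  apply Finset.sum_congr rfl
  intro k hk
  rw [Finset.filter_filter]
  have h4 : (S.filter fun π => desNum π ∈ Finset.range (r + 1) ∧ desNum π = k)
      = S.filter fun π => desNum π = k := by
    apply Finset.filter_congr
    intro π _
    constructor
    · exact fun h => h.2
    · rintro rfl
      exact ⟨hk, rfl⟩
  rw [h4, Finset.sum_const_nat (m := (K + 1 + (r - k)).choose (K + 1))]
  intro π hπ
  rw [(Finset.mem_filter.1 hπ).2]
  congr 1
  rw [Finset.mem_range] at hk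
  omega

end JGF

/-- `J_{2n}(t)/(1-t)^{2n+1} = ∑_{r≥0} C(r(r+1)/2 + n - 1, n) t^r` in `ℚ[[t]]`. -/
theorem J_generating_function (n : ℕ) (hn : 1 ≤ n) :
    PowerSeries.mk (fun k => (fpfInvCount (2 * n) k : ℚ))
      = (1 - PowerSeries.X) ^ (2 * n + 1)
          * PowerSeries.mk (fun r => ((r * (r + 1) / 2 + n - 1).choose n : ℚ)) := by
  have h : PowerSeries.mk (fun r => ((r * (r + 1) / 2 + n - 1).choose n : ℚ))
      = PowerSeries.mk (fun k => (fpfInvCount (2 * n) k : ℚ))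
        * PowerSeries.mk (fun j => ((2 * n + j).choose (2 * n) : ℚ)) := by
    ext r
    rw [PowerSeries.coeff_mul, PowerSeries.coeff_mk, JGF.count n r hn,
      Finset.Nat.sum_antidiagonal_eq_sum_range_succ_mk]
    push_cast
    apply Finset.sum_congr rfl
    intro k _
    simp
  rw [h, mul_comm ((1 - PowerSeries.X) ^ (2 * n + 1)), mul_assoc, PowerSeries.mk_add_choose_mul_one_sub_pow_eq_one, mul_one]
end

section
/- For each fixed k ≥ 1, J_{2n,k} = ∑_{i=0}^{k} (-1)^{k-i} C(2n+1, k-i) C(i(i+1)/2 + n - 1, i(i+1)/2 - 1) is, as a function of n, a polynomial in n of degree d = k(k+1)/2 - 1 with leading coefficient 1/d!. -/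
open Finset Polynomial

namespace JPoly

/-- Swap on lexicographic pairs. -/
def sw {m : ℕ} (q : Fin m ×ₗ Fin m) : Fin m ×ₗ Fin m := toLex ((ofLex q).2, (ofLex q).1)

theorem sw_sw {m : ℕ} (q : Fin m ×ₗ Fin m) : sw (sw q) = q := rfl

theorem sw_inj {m : ℕ} {p q : Fin m ×ₗ Fin m} (h : sw p = sw q) : p = q := by
  rw [← sw_sw p, h, sw_sw]

theorem mono_unique {N : ℕ} {α : Type*} [PartialOrder α] {u v : Fin N → α}
    (hu : Monotone u) (hv : Monotone v)
    (h : (univ : Finset (Fin N)).val.map u = (univ : Finset (Fin N)).val.map v) : u = v := by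
  rw [Fin.univ_val_map, Fin.univ_val_map, Multiset.coe_eq_coe] at h
  exact List.ofFn_injective (h.eq_of_pairwise' hu.sortedLE_ofFn.pairwise hv.sortedLE_ofFn.pairwise)

theorem map_perm_val {N : ℕ} {α : Type*} (u : Fin N → α) (σ : Equiv.Perm (Fin N)) :
    (univ : Finset (Fin N)).val.map (u ∘ σ) = (univ : Finset (Fin N)).val.map u := by
  rw [← Multiset.map_map]
  congr 1
  have := congrArg Finset.val (Finset.map_univ_equiv σ)
  rw [Finset.map_val] at this
  exact this

theorem mono_exists {N : ℕ} {α : Type*} [LinearOrder α] (t : Multiset α)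
    (ht : Multiset.card t = N) :
    ∃ w : Fin N → α, Monotone w ∧ (univ : Finset (Fin N)).val.map w = t := by
  obtain ⟨l, rfl⟩ : ∃ l : List α, (l : Multiset α) = t := ⟨t.toList, t.coe_toList⟩
  rw [Multiset.coe_card] at ht
  subst ht
  refine ⟨l.get ∘ Tuple.sort l.get, Tuple.monotone_sort _, ?_⟩
  rw [map_perm_val, Fin.univ_val_map]
  simp

/-- The compatibility relation. -/
def Good {N m : ℕ} (π : Equiv.Perm (Fin N)) (f : Fin N → Fin m) : Prop :=
  ∀ j j' : Fin N, (j' : ℕ) = (j : ℕ) + 1 → f j ≤ f j' ∧ (π j' < π j → f j < f j')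

instance {N m : ℕ} (π : Equiv.Perm (Fin N)) (f : Fin N → Fin m) : Decidable (Good π f) := by
  unfold Good; infer_instance

theorem Good.block {N m : ℕ} {π : Equiv.Perm (Fin N)} {f : Fin N → Fin m} (h : Good π f) :
    ∀ d : ℕ, ∀ j j' : Fin N, (j' : ℕ) = (j : ℕ) + d + 1 → f j ≤ f j' ∧ (f j = f j' → π j < π j') := by
  have key : ∀ j j' : Fin N, (j' : ℕ) = (j : ℕ) + 1 → f j ≤ f j' ∧ (f j = f j' → π j < π j') := by
    intro j j' hj
    refine ⟨(h j j' hj).1, fun he => ?_⟩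
    rcases lt_trichotomy (π j) (π j') with h1 | h1 | h1
    · exact h1
    · have := π.injective h1
      subst this; omega
    · exact absurd he ((h j j' hj).2 h1).ne
  intro d
  induction d with
  | zero => exact fun j j' hj => key j j' hj
  | succ d ih =>
    intro j j' hj
    have hlt := j'.2
    obtain ⟨a1, a2⟩ := ih j ⟨j + d + 1, by omega⟩ rfl
    obtain ⟨b1, b2⟩ := key ⟨j + d + 1, by omega⟩ j' (by simp; omega)
    refine ⟨a1.trans b1, fun he => ?_⟩
    have e1 : f j = f ⟨j + d + 1, by omega⟩ := le_antisymm a1 (he ▸ b1)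
    exact (a2 e1).trans (b2 (e1 ▸ he))

theorem Good.mono {N m : ℕ} {π : Equiv.Perm (Fin N)} {f : Fin N → Fin m} (h : Good π f) :
    Monotone f := by
  intro j j' hj
  rcases hj.eq_or_lt with rfl | hj
  · exact le_rfl
  · exact (h.block (j' - j - 1) j j' (by have : (j:ℕ) < j' := hj
                                         omega)).1

theorem Good.lt {N m : ℕ} {π : Equiv.Perm (Fin N)} {f : Fin N → Fin m} (h : Good π f)
    {j j' : Fin N} (hj : j < j') (he : f j = f j') : π j < π j' :=
  (h.block (j' - j - 1) j j' (by have : (j:ℕ) < j' := hj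
                                 omega)).2 he

/-- The biword. -/
def wd {N m : ℕ} (π : Equiv.Perm (Fin N)) (f : Fin N → Fin m) (j : Fin N) : Fin m ×ₗ Fin m :=
  toLex (f j, f (π j))

theorem Good.wd_mono {N m : ℕ} {π : Equiv.Perm (Fin N)} {f : Fin N → Fin m} (h : Good π f) :
    Monotone (wd π f) := by
  intro j j' hj
  rcases hj.eq_or_lt with rfl | hj
  · exact le_rfl
  · rw [wd, wd, Prod.Lex.toLex_le_toLex]
    rcases (h.mono hj.le).eq_or_lt with he | hl
    · exact Or.inr ⟨he, h.mono (h.lt hj he).le⟩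
    · exact Or.inl hl

theorem invol_apply {N : ℕ} {π : Equiv.Perm (Fin N)} (h : π * π = 1) (j : Fin N) :
    π (π j) = j := by
  rw [← Equiv.Perm.mul_apply, h]; rfl

theorem sw_wd {N m : ℕ} {π : Equiv.Perm (Fin N)} (f : Fin N → Fin m) (hπ : π * π = 1) :
    (sw ∘ wd π f) ∘ π = wd π f := by
  funext j
  simp [sw, wd, invol_apply hπ]

theorem Good.eq_sort {N m : ℕ} {π : Equiv.Perm (Fin N)} {f : Fin N → Fin m} (h : Good π f)
    (hπ : π * π = 1) : π = Tuple.sort (sw ∘ wd π f) := by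
  rw [Tuple.eq_sort_iff, sw_wd f hπ]
  refine ⟨h.wd_mono, fun i j hij he => ?_⟩
  have e1 := congrFun (sw_wd f hπ) i
  have e2 := congrFun (sw_wd f hπ) j
  simp only [Function.comp] at e1 e2 he
  rw [e1, e2] at he
  exact h.lt hij (congrArg (fun q => (ofLex q).1) he)

theorem Good.ne {N m : ℕ} {π : Equiv.Perm (Fin N)} {f : Fin N → Fin m} (h : Good π f)
    (hπ : π * π = 1) (hf : ∀ i, π i ≠ i) (j : Fin N) : f j ≠ f (π j) := by
  intro he
  rcases lt_trichotomy j (π j) with h1 | h1 | h1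
  · have := h.lt h1 he
    rw [invol_apply hπ] at this
    exact lt_asymm h1 this
  · exact hf j h1.symm
  · have := h.lt h1 he.symm
    rw [invol_apply hπ] at this
    exact lt_asymm h1 this

/-- Off-diagonal upper pairs. -/
def up {m : ℕ} (q : Fin m ×ₗ Fin m) : Prop := (ofLex q).1 < (ofLex q).2

instance {m : ℕ} : DecidablePred (up (m := m)) := fun q => by unfold up; infer_instance

/-- Multiset of the biword. -/
def wm {N m : ℕ} (π : Equiv.Perm (Fin N)) (f : Fin N → Fin m) : Multiset (Fin m ×ₗ Fin m) :=
  (univ : Finset (Fin N)).val.map (wd π f)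

theorem wm_sw {N m : ℕ} {π : Equiv.Perm (Fin N)} (f : Fin N → Fin m) (hπ : π * π = 1) :
    (wm π f).map sw = wm π f := by
  rw [wm, Multiset.map_map, ← map_perm_val (sw ∘ wd π f) π, sw_wd f hπ]

theorem Good.wm_eq {N m : ℕ} {π : Equiv.Perm (Fin N)} {f : Fin N → Fin m} (h : Good π f)
    (hπ : π * π = 1) (hf : ∀ i, π i ≠ i) :
    wm π f = (wm π f).filter up + ((wm π f).filter up).map sw := by
  conv_lhs => rw [← Multiset.filter_add_not up (wm π f)]
  congr 1
  have : (wm π f).filter (fun q => ¬ up q) = (wm π f).filter (fun q => up (sw q)) := by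
    apply Multiset.filter_congr
    intro q hq
    simp only [wm, Multiset.mem_map] at hq
    obtain ⟨j, -, rfl⟩ := hq
    have := h.ne hπ hf j
    simp only [up, sw, wd, ofLex_toLex, not_lt]
    exact ⟨fun h => lt_of_le_of_ne h this.symm, le_of_lt⟩
  rw [this]
  conv_rhs => rw [← wm_sw f hπ, Multiset.filter_map, Multiset.map_map]
  simp only [Function.comp_def, sw_sw, Multiset.map_id']

theorem Good.card_wm {n m : ℕ} {π : Equiv.Perm (Fin (2 * n))} {f : Fin (2 * n) → Fin m}
    (h : Good π f) (hπ : π * π = 1) (hf : ∀ i, π i ≠ i) :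
    Multiset.card ((wm π f).filter up) = n := by
  have := congrArg Multiset.card (h.wm_eq hπ hf)
  rw [Multiset.card_add, Multiset.card_map] at this
  have h2 : Multiset.card (wm π f) = 2 * n := by simp [wm]
  omega

/-- The set of compatible pairs. -/
def pairs (n m : ℕ) : Finset (Equiv.Perm (Fin (2 * n)) × (Fin (2 * n) → Fin m)) :=
  univ.filter fun p => p.1 * p.1 = 1 ∧ (∀ i, p.1 i ≠ i) ∧ Good p.1 p.2

theorem pairs_surj {n m : ℕ} (s : Multiset (Fin m ×ₗ Fin m)) (hs : ∀ q ∈ s, up q)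
    (hn : Multiset.card s = n) :
    ∃ p ∈ pairs n m, (wm p.1 p.2).filter up = s := by
  obtain ⟨w, hw, ht⟩ := mono_exists (N := 2 * n) (s + s.map sw) (by simp [hn]; omega)
  set π := Tuple.sort (sw ∘ w) with hπdef
  obtain ⟨h1, h2⟩ := Tuple.eq_sort_iff.1 hπdef
  have hsw : (sw ∘ w) ∘ π = w := by
    apply mono_unique h1 hw
    rw [map_perm_val, ← Multiset.map_map, ht, Multiset.map_add, Multiset.map_map, add_comm]
    simp only [Function.comp_def, sw_sw, Multiset.map_id']
  have hsw1 : ∀ j, sw (w (π j)) = w j := fun j => congrFun hsw j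
  have hsw2 : ∀ j, w (π j) = sw (w j) := fun j => by rw [← hsw1 j, sw_sw]
  have hsw3 : ∀ j, w (π⁻¹ j) = sw (w j) := fun j => by
    have := hsw1 (π⁻¹ j)
    rw [← this]; simp
  have hlt : ∀ i j, i < j → w i = w j → π i < π j := by
    intro i j hij he
    apply h2 i j hij
    simp only [Function.comp, hsw1, he]
  have hinv : π⁻¹ = π := by
    conv_rhs => rw [hπdef]
    rw [Tuple.eq_sort_iff]
    have hc : (sw ∘ w) ∘ (π⁻¹ : Equiv.Perm _) = w := by
      funext j
      simp only [Function.comp, hsw3, sw_sw]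
    rw [hc]
    refine ⟨hw, fun i j hij he => ?_⟩
    simp only [Function.comp, hsw3, sw_sw] at he
    by_contra hcon
    rcases (not_lt.1 hcon).eq_or_lt with h3 | h3
    · exact hij.ne (π⁻¹.injective h3.symm)
    · have := hlt _ _ h3 (by rw [hsw3, hsw3, he])
      simp at this
      exact lt_asymm hij this
  have hπ : π * π = 1 := by
    nth_rw 1 [← hinv]; simp
  have hdiag : ∀ j, (ofLex (w j)).1 ≠ (ofLex (w j)).2 := by
    intro j
    have : w j ∈ s + s.map sw := by
      rw [← ht]; exact Multiset.mem_map_of_mem _ (Finset.mem_univ_val j)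
    rw [Multiset.mem_add, Multiset.mem_map] at this
    rcases this with h | ⟨q, h, h'⟩
    · exact (hs _ h).ne
    · rw [← h']; exact (hs _ h).ne'
  set f : Fin (2 * n) → Fin m := fun j => (ofLex (w j)).1 with hf
  have hfπ : ∀ j, f (π j) = (ofLex (w j)).2 := fun j => by simp only [hf, hsw2, sw, ofLex_toLex]
  have hwd : wd π f = w := by
    funext j
    rw [wd, hfπ]; rfl
  have hfm : Monotone f := by
    intro i j hij
    have := hw hij
    rw [Prod.Lex.le_iff] at this
    rcases this with h | h
    · exact h.le
    · exact h.1.le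
  refine ⟨(π, f), ?_, ?_⟩
  · simp only [pairs, Finset.mem_filter, Finset.mem_univ, true_and]
    refine ⟨hπ, fun i hi => ?_, fun j j' hj => ?_⟩
    · apply hdiag i
      rw [← hfπ, hi]
    · have hjj : j < j' := by
        rw [Fin.lt_def]; omega
      refine ⟨hfm hjj.le, fun hd => ?_⟩
      rcases (hfm hjj.le).eq_or_lt with he | hl
      · exfalso
        have h5 : f (π j) ≤ f (π j') := by
          rw [hfπ, hfπ]
          have := hw hjj.le
          rw [Prod.Lex.le_iff] at this
          rcases this with h | h
          · exact absurd he h.ne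
          · exact h.2
        have h6 : f (π j) = f (π j') := le_antisymm h5 (hfm hd.le)
        rw [hfπ, hfπ] at h6
        have : w j = w j' := by
          rw [← toLex_ofLex (w j), ← toLex_ofLex (w j')]
          congr 1
          exact Prod.ext he h6
        exact lt_asymm hd (hlt j j' hjj this)
      · exact hl
  · show Multiset.filter up (wm π f) = s
    rw [wm, hwd, ht, Multiset.filter_add, Multiset.filter_eq_self.2 hs, Multiset.filter_eq_nil.2,
      add_zero]
    intro q hq
    rw [Multiset.mem_map] at hq
    obtain ⟨q', h, rfl⟩ := hq
    exact (hs _ h).asymm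

theorem card_up (m : ℕ) : Fintype.card {q : Fin m ×ₗ Fin m // up q} = m * (m - 1) / 2 := by
  rw [← Finset.sum_range_id, Finset.sum_range]
  have e : {q : Fin m ×ₗ Fin m // up q} ≃ (Σ b : Fin m, Finset.Iio b) :=
    { toFun := fun q => ⟨(ofLex q.1).2, ⟨(ofLex q.1).1, Finset.mem_Iio.2 q.2⟩⟩
      invFun := fun x => ⟨toLex (x.2.1, x.1), Finset.mem_Iio.1 x.2.2⟩
      left_inv := fun q => rfl
      right_inv := fun x => rfl }
  rw [Fintype.card_congr e, Fintype.card_sigma]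
  simp only [Fintype.card_coe, Fin.card_Iio]

theorem card_pairs (n m : ℕ) : (pairs n m).card = (m * (m - 1) / 2).multichoose n := by
  rw [← card_up, ← Sym.card_sym_eq_multichoose, ← Finset.card_univ]
  symm
  have inj : Function.Injective
      (fun s : Sym {q : Fin m ×ₗ Fin m // up q} n => (s : Multiset {q : Fin m ×ₗ Fin m // up q}).map Subtype.val) := by
    intro s t h
    exact Sym.coe_injective (Multiset.map_injective Subtype.val_injective h)
  rw [← Finset.card_image_of_injective _ inj]
  have inj2 : Set.InjOn (fun p : Equiv.Perm (Fin (2 * n)) × (Fin (2 * n) → Fin m) =>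
      (wm p.1 p.2).filter up) (pairs n m) := by
    rintro ⟨π, f⟩ hp ⟨σ, g⟩ hq h
    simp only [pairs, Finset.coe_filter, Finset.mem_univ, true_and, Set.mem_ofPred_eq] at hp hq h
    have hW : wm π f = wm σ g := by
      rw [hp.2.2.wm_eq hp.1 hp.2.1, hq.2.2.wm_eq hq.1 hq.2.1, h]
    have hw : wd π f = wd σ g := mono_unique hp.2.2.wd_mono hq.2.2.wd_mono hW
    have h1 : π = σ := by
      rw [hp.2.2.eq_sort hp.1, hq.2.2.eq_sort hq.1, hw]
    have h2 : f = g := by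
      funext j
      exact congrArg (fun q => (ofLex q).1) (congrFun hw j)
    rw [h1, h2]
  rw [← Finset.card_image_of_injOn inj2]
  congr 1
  ext s
  simp only [Finset.mem_image, Finset.mem_univ, true_and]
  constructor
  · rintro ⟨t, rfl⟩
    apply pairs_surj
    · intro q hq
      rw [Multiset.mem_map] at hq
      obtain ⟨q', -, rfl⟩ := hq
      exact q'.2
    · simp
  · rintro ⟨p, hp, rfl⟩
    simp only [pairs, Finset.mem_filter, Finset.mem_univ, true_and] at hp
    have hall : ∀ q ∈ (wm p.1 p.2).filter up, up q := fun q hq => (Multiset.mem_filter.1 hq).2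
    refine ⟨⟨((wm p.1 p.2).filter up).attach.map (fun q => ⟨q.1, hall q.1 q.2⟩), ?_⟩, ?_⟩
    · rw [Multiset.card_map, Multiset.card_attach]
      exact hp.2.2.card_wm hp.1 hp.2.1
    · simp only [Sym.coe_mk, Multiset.map_map, Function.comp_def]
      exact Multiset.attach_map_val _

end JPoly

namespace JPoly

theorem card_strictMono (N M : ℕ) :
    ((univ : Finset (Fin N → Fin M)).filter fun g => StrictMono g).card = M.choose N := by
  classical
  have : (Finset.powersetCard N (univ : Finset (Fin M))).card = M.choose N := by simp
  rw [← this]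
  refine Finset.card_bij (fun g _ => univ.image g) ?_ ?_ ?_
  · intro g hg
    simp only [Finset.mem_filter, Finset.mem_univ, true_and] at hg
    simp [Finset.mem_powersetCard, Finset.card_image_of_injective _ hg.injective]
  · intro g hg g' hg' h
    simp only [Finset.mem_filter, Finset.mem_univ, true_and] at hg hg'
    rw [← StrictMono.range_inj hg hg']
    have := congrArg (fun s : Finset (Fin M) => (s : Set (Fin M))) h
    simpa using this
  · intro s hs
    rw [Finset.mem_powersetCard] at hs
    refine ⟨s.orderEmbOfFin hs.2, ?_, ?_⟩
    · simp [(s.orderEmbOfFin hs.2).strictMono]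
    · simp

theorem chain_le {N : ℕ} (a b : Fin N → ℕ)
    (h : ∀ j j' : Fin N, (j' : ℕ) = j + 1 → a j + b j' ≤ a j' + b j) :
    ∀ (d : ℕ) (j j' : Fin N), (j' : ℕ) = j + d → a j + b j' ≤ a j' + b j := by
  intro d
  induction d with
  | zero =>
    intro j j' hj
    have : j' = j := Fin.ext (by omega)
    subst this; omega
  | succ d ih =>
    intro j j' hj
    have hlt := j'.2
    have h1 := ih j ⟨j + d, by omega⟩ rfl
    have h2 := h ⟨j + d, by omega⟩ j' (by simp; omega)
    omega

theorem card_compat (M i k : ℕ) (P : Fin (M + 1) → Prop) [DecidablePred P] (c : ℕ → ℕ)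
    (c0 : c 0 = 0) (cM : c M = k)
    (cs : ∀ j j' : Fin (M + 1), (j' : ℕ) = j + 1 → c j' = c j + if P j then 1 else 0) :
    ((univ : Finset (Fin (M + 1) → Fin (i + 1))).filter fun f =>
      ∀ j j' : Fin (M + 1), (j' : ℕ) = j + 1 → f j ≤ f j' ∧ (P j → f j < f j')).card
      = if k ≤ i then (M + 1 + (i - k)).choose (M + 1) else 0 := by
  have hcj : ∀ j : Fin (M + 1), c j ≤ j := by
    intro j
    have := chain_le (fun j : Fin (M + 1) => (0 : ℕ) + j) (fun j => c j) (by
      intro j j' hj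
      have := cs j j' hj
      split_ifs at this <;> simp <;> omega) j 0 j (by simp)
    simp [c0] at this
    exact this
  have hck : ∀ j : Fin (M + 1), c j ≤ k := by
    intro j
    have := chain_le (fun j : Fin (M + 1) => c j) (fun j => 0) (by
      intro j j' hj
      have := cs j j' hj
      split_ifs at this <;> omega) (M - j) j (Fin.last M) (by have := j.2; simp; omega)
    simp [cM] at this
    exact this
  have hf : ∀ f : Fin (M + 1) → Fin (i + 1),
      (∀ j j' : Fin (M + 1), (j' : ℕ) = j + 1 → f j ≤ f j' ∧ (P j → f j < f j')) →
      ∀ j, (f j : ℕ) + k ≤ i + c j := by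
    intro f h j
    have := chain_le (fun j : Fin (M + 1) => (f j : ℕ)) (fun j => c j) (by
      intro j j' hj
      have h1 := cs j j' hj
      obtain ⟨h2, h3⟩ := h j j' hj
      rw [Fin.le_def] at h2
      rw [Fin.lt_def] at h3
      split_ifs at h1 with hP
      · have := h3 hP; omega
      · omega) (M - j) j (Fin.last M) (by have := j.2; simp; omega)
    have h2 := (f (Fin.last M)).2
    simp only [Fin.val_last, cM] at this
    omega
  split_ifs with hki
  swap
  · rw [Finset.card_eq_zero, Finset.filter_eq_empty_iff]
    intro f _ h
    have := hf f h 0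
    simp [c0] at this
    omega
  rw [← card_strictMono]
  have hg : ∀ g : Fin (M + 1) → Fin (M + 1 + (i - k)), StrictMono g →
      ∀ j : Fin (M + 1), (j : ℕ) ≤ g j ∧ (g j : ℕ) + k ≤ i + j := by
    intro g h j
    have hs : ∀ j j' : Fin (M + 1), (j' : ℕ) = j + 1 → (g j : ℕ) + j' ≤ g j' + j := by
      intro j j' hj
      have : g j < g j' := h (by rw [Fin.lt_def]; omega)
      rw [Fin.lt_def] at this
      omega
    have h1 := chain_le (fun j => (g j : ℕ)) (fun j => (j : ℕ)) hs (M - j) j (Fin.last M)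
      (by have := j.2; simp; omega)
    have h2 := chain_le (fun j => (g j : ℕ)) (fun j => (j : ℕ)) hs j 0 j (by simp)
    have h3 := (g (Fin.last M)).2
    have h4 := j.2
    simp only [Fin.val_last] at h1
    simp only [Fin.val_zero] at h2
    omega
  refine Finset.card_bij'
    (fun f hf' => fun j => ⟨f j + j - c j, by
      have := hf f (Finset.mem_filter.1 hf').2 j
      have := j.2
      have := hck j
      omega⟩)
    (fun g hg' => fun j => ⟨g j + c j - j, by
      have := hg g (Finset.mem_filter.1 hg').2 j
      have := hck j
      omega⟩) ?_ ?_ ?_ ?_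
  · intro f hf'
    have h := (Finset.mem_filter.1 hf').2
    refine Finset.mem_filter.2 ⟨Finset.mem_univ _, Fin.strictMono_iff_lt_succ.2 fun j => ?_⟩
    obtain ⟨h2, h3⟩ := h j.castSucc j.succ (by simp)
    have h1 := cs j.castSucc j.succ (by simp)
    have h4 := hcj j.castSucc
    rw [Fin.le_def] at h2
    rw [Fin.lt_def] at h3
    rw [Fin.lt_def]
    simp only [Fin.val_castSucc, Fin.val_succ] at h1 h4 ⊢
    split_ifs at h1 with hP
    · have := h3 hP; omega
    · omega
  · intro g hg'
    have h := (Finset.mem_filter.1 hg').2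
    refine Finset.mem_filter.2 ⟨Finset.mem_univ _, fun j j' hj => ?_⟩
    have h1 := cs j j' hj
    have h2 : g j < g j' := h (by rw [Fin.lt_def]; omega)
    have h3 := hg g h j
    rw [Fin.lt_def] at h2
    rw [Fin.le_def, Fin.lt_def]
    simp only
    split_ifs at h1 with hP
    · refine ⟨?_, fun _ => ?_⟩ <;> omega
    · refine ⟨?_, fun h => absurd h hP⟩; omega
  · intro f hf'
    funext j
    have := hcj j
    apply Fin.ext
    simp only
    omega
  · intro g hg'
    funext j
    have := hg g (Finset.mem_filter.1 hg').2 j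
    apply Fin.ext
    simp only
    omega

theorem card_good (N i : ℕ) (hN : 1 ≤ N) (π : Equiv.Perm (Fin N)) :
    ((univ : Finset (Fin N → Fin (i + 1))).filter fun f => Good π f).card
      = if desNum π ≤ i then (N + (i - desNum π)).choose N else 0 := by
  obtain ⟨M, rfl⟩ : ∃ M, N = M + 1 := ⟨N - 1, by omega⟩
  set P : Fin (M + 1) → Prop := fun j => ∃ j' : Fin (M + 1), (j' : ℕ) = j + 1 ∧ π j' < π j with hP
  have := card_compat M i (desNum π) P (fun x => (univ.filter fun j => P j ∧ (j : ℕ) < x).card)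
    (by simp) ?_ ?_
  · rw [← this]
    congr 1
    apply Finset.filter_congr
    intro f _
    unfold Good
    refine forall_congr' fun j => forall_congr' fun j' => forall_congr' fun hj => ?_
    refine and_congr_right fun _ => imp_congr_left ?_
    constructor
    · exact fun h => ⟨j', hj, h⟩
    · rintro ⟨j'', h1, h2⟩
      have : j'' = j' := Fin.ext (by omega)
      exact this ▸ h2
  · unfold desNum
    congr 1
    apply Finset.filter_congr
    intro j _
    refine ⟨fun h => h.1, fun h => ⟨h, ?_⟩⟩
    obtain ⟨j', h1, _⟩ := h
    have := j'.2
    omega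
  · intro j j' hj
    have e : (univ.filter fun x : Fin (M + 1) => P x ∧ (x : ℕ) < j') =
        (univ.filter fun x : Fin (M + 1) => P x ∧ (x : ℕ) < j) ∪ if P j then {j} else ∅ := by
      ext x
      by_cases hx : x = j
      · subst hx
        by_cases hp : P x <;> simp [hp, hj]
      · have : (x : ℕ) ≠ j := fun h => hx (Fin.ext h)
        by_cases hp : P j <;> simp [hp, hj, hx] <;> intro _ <;> omega
    rw [e, Finset.card_union_of_disjoint]
    · by_cases hp : P j <;> simp [hp]
    · by_cases hp : P j <;> simp [hp]

end JPoly

namespace JPoly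

/-- Fixed-point-free involutions. -/
def fpf (N : ℕ) : Finset (Equiv.Perm (Fin N)) :=
  univ.filter fun π => π * π = 1 ∧ ∀ i, π i ≠ i

theorem sum_formula (n i : ℕ) (hn : 1 ≤ n) :
    (((i + 1) * i / 2).multichoose n) =
      ∑ π ∈ fpf (2 * n), if desNum π ≤ i then (2 * n + (i - desNum π)).choose (2 * n) else 0 := by
  have h := card_pairs n (i + 1)
  rw [Nat.add_sub_cancel] at h
  rw [← h, pairs, Finset.card_filter, Fintype.sum_prod_type, fpf, Finset.sum_filter]
  refine Finset.sum_congr rfl fun π _ => ?_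
  rw [← card_good (2 * n) i (by omega) π]
  split_ifs with hπ
  · rw [Finset.card_filter]
    refine Finset.sum_congr rfl fun f _ => ?_
    simp [hπ.1, hπ.2]
  · refine Finset.sum_eq_zero fun f _ => ?_
    rw [if_neg]
    exact fun h => hπ ⟨h.1, h.2.1⟩

theorem coeff_one_sub_pow (N q : ℕ) :
    PowerSeries.coeff q ((1 - PowerSeries.X : PowerSeries ℚ) ^ N) = (-1) ^ q * (N.choose q : ℚ) := by
  have h : ((1 - PowerSeries.X : PowerSeries ℚ) ^ N) =
      (((Polynomial.X + 1 : Polynomial ℚ) ^ N).comp (Polynomial.C (-1) * Polynomial.X) : Polynomial ℚ) := by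
    simp [Polynomial.pow_comp]
    ring
  rw [h, Polynomial.coeff_coe, Polynomial.comp_C_mul_X_coeff, Polynomial.coeff_X_add_one_pow]
  ring

theorem fpf_formula (n k : ℕ) (hn : 1 ≤ n) :
    (fpfInvCount (2 * n) k : ℚ) = ∑ x ∈ Finset.HasAntidiagonal.antidiagonal k,
      ((((x.1 + 1) * x.1 / 2).multichoose n : ℕ) : ℚ) *
        ((-1) ^ x.2 * ((2 * n + 1).choose x.2 : ℚ)) := by
  set G : PowerSeries ℚ := PowerSeries.mk fun i => ((((i + 1) * i / 2).multichoose n : ℕ) : ℚ)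
  set J : PowerSeries ℚ := ∑ π ∈ fpf (2 * n), PowerSeries.X ^ desNum π
  have hG : G = J * PowerSeries.mk fun i => ((2 * n + i).choose (2 * n) : ℚ) := by
    ext i
    rw [Finset.sum_mul, map_sum, PowerSeries.coeff_mk, sum_formula n i hn, Nat.cast_sum]
    refine Finset.sum_congr rfl fun π _ => ?_
    rw [PowerSeries.coeff_X_pow_mul']
    split_ifs
    · simp
    · simp
  have hJ : G * (1 - PowerSeries.X) ^ (2 * n + 1) = J := by
    rw [hG, mul_assoc, PowerSeries.mk_add_choose_mul_one_sub_pow_eq_one, mul_one]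
  have h1 : PowerSeries.coeff k J = (fpfInvCount (2 * n) k : ℚ) := by
    rw [map_sum]
    simp only [PowerSeries.coeff_X_pow]
    rw [Finset.sum_boole, fpf, Finset.filter_filter, fpfInvCount]
    congr 2
    apply Finset.filter_congr
    intro π _
    rw [and_assoc, eq_comm (a := k)]
  rw [← h1, ← hJ, PowerSeries.coeff_mul]
  refine Finset.sum_congr rfl fun x _ => ?_
  rw [coeff_one_sub_pow, PowerSeries.coeff_mk]

/-- Polynomial for the factor `C(2n+1,q)`. -/
noncomputable def cp (q : ℕ) : Polynomial ℚ :=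
  Polynomial.C ((q.factorial : ℚ)⁻¹) *
    (descPochhammer ℚ q).comp (Polynomial.C 2 * Polynomial.X + Polynomial.C 1)

theorem cp_eval (q n : ℕ) : (cp q).eval (n : ℚ) = ((2 * n + 1).choose q : ℚ) := by
  rw [Nat.cast_choose_eq_descPochhammer_div, cp]
  simp [div_eq_inv_mul]

theorem cp_deg (q : ℕ) : (cp q).natDegree ≤ q := by
  refine (Polynomial.natDegree_C_mul_le _ _).trans ?_
  refine Polynomial.natDegree_comp_le.trans ?_
  rw [descPochhammer_natDegree]
  have : (Polynomial.C (2:ℚ) * Polynomial.X + Polynomial.C 1).natDegree ≤ 1 :=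
    Polynomial.natDegree_linear_le
  calc q * _ ≤ q * 1 := Nat.mul_le_mul_left _ this
    _ = q := mul_one q

/-- Polynomial for one term of the sum. -/
noncomputable def sumTerm (p q : ℕ) : Polynomial ℚ :=
  if p = 0 then 0 else
    Polynomial.preHilbertPoly ℚ ((p + 1) * p / 2 - 1) 0 * (Polynomial.C ((-1) ^ q) * cp q)

theorem tri_pos {p : ℕ} (hp : 1 ≤ p) : 1 ≤ (p + 1) * p / 2 := by
  rw [Nat.le_div_iff_mul_le (by norm_num)]
  nlinarith

theorem sumTerm_eval (p q n : ℕ) (hn : 1 ≤ n) : (sumTerm p q).eval (n : ℚ) =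
    ((((p + 1) * p / 2).multichoose n : ℕ) : ℚ) * ((-1) ^ q * ((2 * n + 1).choose q : ℚ)) := by
  unfold sumTerm
  split_ifs with hp
  · subst hp
    obtain ⟨m, rfl⟩ : ∃ m, n = m + 1 := ⟨n - 1, by omega⟩
    simp [Nat.multichoose_zero_succ]
  · have := tri_pos (Nat.one_le_iff_ne_zero.2 hp)
    rw [Polynomial.eval_mul, Polynomial.eval_mul, cp_eval, Polynomial.eval_C,
      Polynomial.preHilbertPoly_eq_choose_sub_add ℚ _ (Nat.zero_le n), Nat.multichoose_eq]
    obtain ⟨d, hd⟩ : ∃ d, (p + 1) * p / 2 = d + 1 := ⟨(p + 1) * p / 2 - 1, by omega⟩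
    rw [hd, Nat.add_sub_cancel, Nat.sub_zero, show d + 1 + n - 1 = d + n by omega,
      add_comm n d, Nat.choose_symm_add]

theorem tri_lt (p q : ℕ) (hp : 1 ≤ p) (hq : 1 ≤ q) :
    (p + 1) * p / 2 - 1 + q < (p + q + 1) * (p + q) / 2 - 1 := by
  have h1 := tri_pos hp
  have h2 : (p + 1) * p / 2 + q + 1 ≤ (p + q + 1) * (p + q) / 2 := by
    rw [Nat.le_div_iff_mul_le (by norm_num)]
    have := Nat.div_mul_le_self ((p + 1) * p) 2
    nlinarith
  omega

end JPoly

/-- For fixed `k ≥ 1`, `J_{2n,k}` is a polynomial in `n` of degree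
`d = k(k+1)/2 - 1` with leading coefficient `1/d!`. -/
theorem J_polynomial_in_n (k : ℕ) (hk : 1 ≤ k) :
    ∃ p : Polynomial ℚ,
      p.natDegree = k * (k + 1) / 2 - 1 ∧
      p.leadingCoeff = 1 / ((k * (k + 1) / 2 - 1).factorial : ℚ) ∧
      ∀ n : ℕ, k ≤ 2 * n → (fpfInvCount (2 * n) k : ℚ) = p.eval (n : ℚ) := by
  set d := k * (k + 1) / 2 - 1 with hd
  have hcomm : k * (k + 1) = (k + 1) * k := mul_comm _ _
  set P : Polynomial ℚ := ∑ x ∈ Finset.HasAntidiagonal.antidiagonal k, JPoly.sumTerm x.1 x.2 with hP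
  have hmain : JPoly.sumTerm k 0 = Polynomial.preHilbertPoly ℚ d 0 := by
    rw [JPoly.sumTerm, if_neg (by omega), hd, hcomm]
    simp [JPoly.cp]
  have hrest : ∀ x ∈ Finset.HasAntidiagonal.antidiagonal k, x ≠ (k, 0) → (JPoly.sumTerm x.1 x.2).degree < (d : ℕ) := by
    rintro ⟨p, q⟩ hx hne
    rw [Finset.HasAntidiagonal.mem_antidiagonal] at hx
    simp only at hx ⊢
    unfold JPoly.sumTerm
    split_ifs with hp
    · simp
    · have hq : 1 ≤ q := by
        rcases Nat.eq_zero_or_pos q with h | h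
        · exact absurd (by subst h; simp at hx; rw [hx]) hne
        · exact h
      refine Polynomial.degree_le_natDegree.trans_lt ?_
      rw [Nat.cast_lt]
      refine Polynomial.natDegree_mul_le.trans_lt ?_
      have h1 := (Polynomial.natDegree_C_mul_le ((-1 : ℚ) ^ q) (JPoly.cp q)).trans (JPoly.cp_deg q)
      have h2 := JPoly.tri_lt p q (Nat.one_le_iff_ne_zero.2 hp) hq
      rw [Polynomial.natDegree_preHilbertPoly, hd, hcomm, ← hx]
      omega
  have hsplit : P = JPoly.sumTerm k 0 +
      ∑ x ∈ (Finset.HasAntidiagonal.antidiagonal k).erase (k, 0), JPoly.sumTerm x.1 x.2 := by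
    rw [hP, ← Finset.add_sum_erase _ _ (show (k, 0) ∈ Finset.HasAntidiagonal.antidiagonal k by simp)]
  have hne : Polynomial.preHilbertPoly ℚ d 0 ≠ 0 := by
    intro h
    have := Polynomial.leadingCoeff_preHilbertPoly ℚ d 0
    rw [h, Polynomial.leadingCoeff_zero] at this
    exact inv_ne_zero (Nat.cast_ne_zero.2 (Nat.factorial_ne_zero d)) this.symm
  have hdeg : (Polynomial.preHilbertPoly ℚ d 0).degree = (d : ℕ) := by
    rw [Polynomial.degree_eq_natDegree hne, Polynomial.natDegree_preHilbertPoly]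
  have hlt : (∑ x ∈ (Finset.HasAntidiagonal.antidiagonal k).erase (k, 0), JPoly.sumTerm x.1 x.2).degree <
      (Polynomial.preHilbertPoly ℚ d 0).degree := by
    rw [hdeg]
    refine (Polynomial.degree_sum_le _ _).trans_lt ?_
    refine (Finset.sup_lt_iff (WithBot.bot_lt_coe d)).2 ?_
    intro x hx
    rw [Finset.mem_erase] at hx
    exact hrest x hx.2 hx.1
  rw [hmain] at hsplit
  refine ⟨P, ?_, ?_, ?_⟩
  · rw [hsplit, Polynomial.natDegree_add_eq_left_of_degree_lt hlt,
      Polynomial.natDegree_preHilbertPoly]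
  · rw [hsplit, Polynomial.leadingCoeff_add_of_degree_lt' hlt,
      Polynomial.leadingCoeff_preHilbertPoly, one_div]
  · intro n hn
    rw [JPoly.fpf_formula n k (by omega), hP, Polynomial.eval_finsetSum]
    exact Finset.sum_congr rfl fun x _ => (JPoly.sumTerm_eval x.1 x.2 n (by omega)).symm
end
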